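/- arXiv:1707.03892 — 2 statements merged into one kernel-verified Lean document; each statement's English description precedes it below -/
import Mathlib

section
/- If G is a graph with at least 3k vertices and minimum degree at least 2k (k a positive integer), then G contains k vertex-disjoint cycles. -/
/-- `G` contains `k` pairwise vertex-disjoint cycles. -/
def HasDisjointCycles {V : Type*} (G : SimpleGraph V) (k : ℕ) : Prop :=
  ∃ c : Fin k → (v : V) × G.Walk v v,
    (∀ i, (c i).2.IsCycle) ∧
    ∀ i j, i ≠ j → List.Disjoint (c i).2.support (c j).2.support

namespace CorradiHajnal

open scoped Classical

variable {V : Type*}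

/-- The number of neighbours of `v` in `S`. -/
noncomputable def degOn (G : SimpleGraph V) (v : V) (S : Finset V) : ℕ :=
  (S.filter (G.Adj v)).card

/-- Twice the number of edges of `G` inside `S`. -/
noncomputable def degSum (G : SimpleGraph V) (S : Finset V) : ℕ := ∑ v ∈ S, degOn G v S

/-- `S` is nonempty and every vertex of `S` has at least two neighbours in `S`. -/
def Cyclic (G : SimpleGraph V) (S : Finset V) : Prop :=
  S.Nonempty ∧ ∀ v ∈ S, 2 ≤ degOn G v S

/-- `T` contains `j` pairwise disjoint cyclic sets. -/
def Packs (G : SimpleGraph V) (T : Finset V) (j : ℕ) : Prop :=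
  ∃ F : Finset (Finset V), F.card = j ∧ (∀ S ∈ F, Cyclic G S ∧ S ⊆ T) ∧
    (F : Set (Finset V)).PairwiseDisjoint id

section degOn

variable {G : SimpleGraph V} {v w a : V} {S T : Finset V}

lemma degOn_mono (h : S ⊆ T) : degOn G v S ≤ degOn G v T :=
  Finset.card_le_card (Finset.filter_subset_filter _ h)

lemma degOn_le_card : degOn G v S ≤ S.card := Finset.card_filter_le _ _

lemma degOn_pos_iff : 0 < degOn G v S ↔ ∃ w ∈ S, G.Adj v w := by
  simp [degOn, Finset.card_pos, Finset.Nonempty]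

lemma adj_of_card_le_degOn (h : S.card ≤ degOn G v S) (hw : w ∈ S) : G.Adj v w := by
  have := Finset.eq_of_subset_of_card_le (Finset.filter_subset (G.Adj v) S) h
  rw [← this] at hw
  exact (Finset.mem_filter.1 hw).2

lemma degOn_insert (ha : a ∉ S) :
    degOn G v (insert a S) = degOn G v S + if G.Adj v a then 1 else 0 := by
  unfold degOn
  rw [Finset.filter_insert]
  split_ifs
  · rw [Finset.card_insert_of_notMem (by simp [ha])]
  · rfl

lemma degOn_insert_self : degOn G v (insert v S) = degOn G v S := by
  simp [degOn, Finset.filter_insert]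

lemma degOn_erase (ha : a ∈ S) :
    degOn G v S = degOn G v (S.erase a) + if G.Adj v a then 1 else 0 := by
  conv_lhs => rw [← Finset.insert_erase ha]
  exact degOn_insert (Finset.notMem_erase a S)

lemma degSum_insert (ha : a ∉ S) :
    degSum G (insert a S) = degSum G S + 2 * degOn G a S := by
  unfold degSum
  rw [Finset.sum_insert ha, degOn_insert_self]
  simp_rw [degOn_insert ha]
  rw [Finset.sum_add_distrib]
  have : (∑ v ∈ S, if G.Adj v a then 1 else 0) = degOn G a S := by
    simp [degOn, G.adj_comm]
  omega

lemma degOn_eq_one_unique (h : degOn G v S ≤ 1) (hw : w ∈ S) (ha : a ∈ S) (hvw : G.Adj v w)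
    (hva : G.Adj v a) : w = a := by
  exact Finset.card_le_one.1 h _ (Finset.mem_filter.2 ⟨hw, hvw⟩) _
    (Finset.mem_filter.2 ⟨ha, hva⟩)

lemma degOn_triple {p q r : V} (hpq : p ≠ q) (hpr : p ≠ r) (hqr : q ≠ r) :
    degOn G v {p, q, r} = (if G.Adj v p then 1 else 0) + (if G.Adj v q then 1 else 0) +
      (if G.Adj v r then 1 else 0) := by
  rw [degOn_insert (by simp [hpq, hpr]), degOn_insert (by simp [hqr])]
  simp only [degOn, Finset.filter_singleton]
  split_ifs <;> simp

lemma degOn_eq_of_not_adj (hST : S ⊆ T)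
    (h : ∀ w ∈ T, w ∉ S → ¬ G.Adj v w) : degOn G v S = degOn G v T := by
  unfold degOn
  congr 1
  ext w
  have := h w
  have := @hST w
  simp only [Finset.mem_filter]
  tauto

lemma degOn_mono_adj {H : SimpleGraph V} (h : ∀ w ∈ S, G.Adj v w → H.Adj v w) :
    degOn G v S ≤ degOn H v S := by
  refine Finset.card_le_card fun w hw => ?_
  rw [Finset.mem_filter] at hw ⊢
  exact ⟨hw.1, h w hw.1 hw.2⟩

end degOn

section Cycles

lemma not_isAcyclic_of_forall_two_neighbors {W : Type*} [Finite W] [Nonempty W]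
    {H : SimpleGraph W} (h : ∀ v, ∃ a b, a ≠ b ∧ H.Adj v a ∧ H.Adj v b) : ¬ H.IsAcyclic := by
  intro hH
  obtain ⟨u, v, p, hp, hmax⟩ := SimpleGraph.Walk.exists_isPath_forall_isPath_length_le_length H
  obtain ⟨a, b, hab, ha, hb⟩ := h u
  have key : ∀ w, H.Adj u w → w = p.snd := by
    intro w hadj
    apply hH.eq_snd_of_adj_start hp hadj
    have : ¬(p.cons hadj.symm).IsPath := by
      intro hpath
      have := hmax _ _ _ hpath
      simp at this
    grind [hp.cons]
  exact hab ((key a ha).trans (key b hb).symm)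

lemma Cyclic.exists_isCycle {G : SimpleGraph V} {S : Finset V} (hS : Cyclic G S) :
    ∃ (v : V) (p : G.Walk v v), p.IsCycle ∧ ∀ w ∈ p.support, w ∈ S := by
  have hne : Nonempty (S : Set V) := hS.1.to_subtype
  have h : ¬ (G.induce (S : Set V)).IsAcyclic := by
    apply not_isAcyclic_of_forall_two_neighbors
    rintro ⟨v, hv⟩
    obtain ⟨a, ha, b, hb, hab⟩ := Finset.one_lt_card.1 (hS.2 v hv)
    rw [Finset.mem_filter] at ha hb
    exact ⟨⟨a, ha.1⟩, ⟨b, hb.1⟩, by simpa using hab, ha.2, hb.2⟩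
  simp only [SimpleGraph.IsAcyclic, not_forall, not_not] at h
  obtain ⟨v, p, hp⟩ := h
  refine ⟨_, p.map (SimpleGraph.Embedding.induce (S : Set V)).toHom,
    hp.map Subtype.val_injective, ?_⟩
  intro w hw
  rw [SimpleGraph.Walk.support_map, List.mem_map] at hw
  obtain ⟨x, -, rfl⟩ := hw
  exact x.2

lemma Packs.exists_cycles {G : SimpleGraph V} {T : Finset V} {k : ℕ} (h : Packs G T k) :
    ∃ c : Fin k → (v : V) × G.Walk v v, (∀ i, (c i).2.IsCycle) ∧
      ∀ i j, i ≠ j → List.Disjoint (c i).2.support (c j).2.support := by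
  obtain ⟨F, hF, hcyc, hdisj⟩ := h
  choose v p hp hsupp using fun S : F => (hcyc S S.2).1.exists_isCycle
  let e := (F.equivFinOfCardEq hF).symm
  refine ⟨fun i => ⟨v (e i), p (e i)⟩, fun i => hp _, fun i j hij w hi hj => ?_⟩
  have hne : ((e i : F) : Finset V) ≠ e j := fun h => hij (e.injective (Subtype.ext h))
  exact Finset.disjoint_left.1 (hdisj (e i).2 (e j).2 hne) (hsupp _ _ hi) (hsupp _ _ hj)

end Cycles

section Packs

variable {G : SimpleGraph V} {S T T' : Finset V} {i j : ℕ}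

lemma Packs.mono (h : Packs G T j) (hT : T ⊆ T') : Packs G T' j := by
  obtain ⟨F, hF, hcyc, hdisj⟩ := h
  exact ⟨F, hF, fun S hS => ⟨(hcyc S hS).1, (hcyc S hS).2.trans hT⟩, hdisj⟩

lemma Cyclic.packs (h : Cyclic G S) : Packs G S 1 :=
  ⟨{S}, by simp, by simpa using h, by simp⟩

lemma Packs.union (h : Packs G T i) (h' : Packs G T' j) (hT : Disjoint T T') :
    Packs G (T ∪ T') (i + j) := by
  obtain ⟨F, rfl, hcyc, hdisj⟩ := h
  obtain ⟨F', rfl, hcyc', hdisj'⟩ := h'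
  have hFF : ∀ S ∈ F, ∀ S' ∈ F', Disjoint S S' := fun S hS S' hS' =>
    Finset.disjoint_of_subset_left (hcyc S hS).2
      (Finset.disjoint_of_subset_right (hcyc' S' hS').2 hT)
  refine ⟨F ∪ F', ?_, ?_, ?_⟩
  · apply Finset.card_union_of_disjoint
    rw [Finset.disjoint_left]
    intro S hS hS'
    have := hFF S hS S hS'
    exact (hcyc S hS).1.1.ne_empty (by simpa using this)
  · intro S hS
    rcases Finset.mem_union.1 hS with h | h
    · exact ⟨(hcyc S h).1, (hcyc S h).2.trans Finset.subset_union_left⟩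
    · exact ⟨(hcyc' S h).1, (hcyc' S h).2.trans Finset.subset_union_right⟩
  · rw [Finset.coe_union]
    apply (Set.pairwiseDisjoint_union).2 ⟨hdisj, hdisj', fun S hS S' hS' _ => hFF S hS S' hS'⟩

lemma Packs.add (h : Packs G T i) (h' : Packs G T' j) (hT : Disjoint T T') {U : Finset V}
    (hU : T ⊆ U) (hU' : T' ⊆ U) : Packs G U (i + j) :=
  (h.union h' hT).mono (Finset.union_subset hU hU')

lemma packs_of_family {F : Finset (Finset V)} (hcyc : ∀ S ∈ F, Cyclic G S ∧ S ⊆ T)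
    (hdisj : (F : Set (Finset V)).PairwiseDisjoint id) : Packs G T F.card :=
  ⟨F, rfl, hcyc, hdisj⟩

lemma Cyclic.three_le_card (h : Cyclic G S) : 3 ≤ S.card := by
  obtain ⟨v, hv⟩ := h.1
  have h1 := h.2 v hv
  have h2 : degOn G v S ≤ (S.erase v).card := by
    rw [degOn_erase hv, if_neg (G.loopless.irrefl v)]
    exact degOn_le_card
  rw [Finset.card_erase_of_mem hv] at h2
  omega

lemma cyclic_triangle {a b c : V} (hab : G.Adj a b) (hac : G.Adj a c) (hbc : G.Adj b c) :
    Cyclic G {a, b, c} := by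
  refine ⟨by simp, fun v hv => ?_⟩
  rw [degOn_triple hab.ne hac.ne hbc.ne]
  simp only [Finset.mem_insert, Finset.mem_singleton] at hv
  rcases hv with rfl | rfl | rfl
  · simp [hab, hac]
  · simp [hab.symm, hbc]
  · simp [hac.symm, hbc.symm]

lemma Cyclic.exists_triangle (h : Cyclic G S) (hS : S.card = 3) {a : V} (ha : a ∈ S) :
    ∃ b c, S = {a, b, c} ∧ G.Adj a b ∧ G.Adj a c ∧ G.Adj b c := by
  have key : ∀ v ∈ S, ∀ w ∈ S, v ≠ w → G.Adj v w := by
    intro v hv w hw hvw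
    have h1 := h.2 v hv
    rw [degOn_erase hv, if_neg (G.loopless.irrefl v)] at h1
    apply adj_of_card_le_degOn (S := S.erase v) _ (Finset.mem_erase.2 ⟨hvw.symm, hw⟩)
    rw [Finset.card_erase_of_mem hv]
    omega
  have h2 : (S.erase a).card = 2 := by rw [Finset.card_erase_of_mem ha]; omega
  obtain ⟨b, c, hbc, hS'⟩ := Finset.card_eq_two.1 h2
  have hb : b ∈ S.erase a := by simp [hS']
  have hc : c ∈ S.erase a := by simp [hS']
  rw [Finset.mem_erase] at hb hc
  refine ⟨b, c, ?_, key _ ha _ hb.2 hb.1.symm, key _ ha _ hc.2 hc.1.symm, key _ hb.2 _ hc.2 hbc⟩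
  rw [← hS', Finset.insert_erase ha]

lemma adj_of_not_adj_of_ne {w a b : V} (h : S.card ≤ degOn G w S + 1) (ha : a ∈ S)
    (hwa : ¬ G.Adj w a) (hb : b ∈ S) (hab : b ≠ a) : G.Adj w b := by
  have h1 := degOn_erase (G := G) (v := w) ha
  rw [if_neg hwa] at h1
  have h2 := Finset.card_erase_add_one ha
  exact adj_of_card_le_degOn (S := S.erase a) (by omega) (Finset.mem_erase.2 ⟨hab, hb⟩)

lemma Cyclic.swap (hC : Cyclic G S) (h3 : S.card = 3) {a w : V} (ha : a ∈ S)
    (hw : ∀ b ∈ S, b ≠ a → G.Adj w b) : Cyclic G (insert w (S.erase a)) := by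
  obtain ⟨b, c, rfl, hab, hac, hbc⟩ := hC.exists_triangle h3 ha
  have : ({a, b, c} : Finset V).erase a = {b, c} :=
    Finset.erase_insert (by simp [hab.ne, hac.ne])
  rw [this]
  exact cyclic_triangle (hw b (by simp) hab.ne') (hw c (by simp) hac.ne') hbc

/-- A set containing no cyclic subset spans a forest, so it has fewer edges than vertices. -/
lemma degSum_add_two_le (hS : S.Nonempty) (h : ∀ S' ⊆ S, ¬ Cyclic G S') :
    degSum G S + 2 ≤ 2 * S.card := by
  induction S using Finset.strongInduction with
  | H S ih =>
    have h1 := h S subset_rfl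
    simp only [Cyclic, hS, true_and, not_forall, not_le] at h1
    obtain ⟨v, hv, hdeg⟩ := h1
    have hlt : degOn G v (S.erase v) ≤ 1 :=
      (degOn_mono (Finset.erase_subset _ _)).trans (by omega)
    have hsum := degSum_insert (G := G) (Finset.notMem_erase v S)
    have hcard := Finset.card_erase_add_one hv
    rw [Finset.insert_erase hv] at hsum
    rcases (S.erase v).eq_empty_or_nonempty with he | hne
    · rw [he] at hsum hcard
      have h0 : degSum G ∅ = 0 := by simp [degSum]
      have h1 : degOn G v ∅ = 0 := by simp [degOn]
      rw [Finset.card_empty] at hcard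
      omega
    · have := ih _ (Finset.erase_ssubset hv) hne
        (fun S' hS' => h S' (hS'.trans (Finset.erase_subset _ _)))
      omega

/-- Two adjacent vertices and an edge `yz` such that each of the two is adjacent to `y` or `z`. -/
lemma packs_two_edges {v w y z : V} (hvw : G.Adj v w) (hyz : G.Adj y z)
    (hv : G.Adj v y ∨ G.Adj v z) (hw : G.Adj w y ∨ G.Adj w z)
    (hvy : v ≠ y) (hvz : v ≠ z) (hwy : w ≠ y) (hwz : w ≠ z) : Packs G {v, w, y, z} 1 := by
  have hfour : ∀ {y z : V}, G.Adj y z → G.Adj v y → G.Adj w z → v ≠ z → w ≠ y →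
      Cyclic G {v, w, y, z} := by
    intro y z hyz hvy hwz hvz hwy
    refine ⟨by simp, fun x hx => ?_⟩
    rw [degOn_insert (by simp [hvw.ne, hvy.ne, hvz]), degOn_triple hwy hwz.ne hyz.ne]
    simp only [Finset.mem_insert, Finset.mem_singleton] at hx
    rcases hx with rfl | rfl | rfl | rfl
    · rw [if_pos hvw, if_pos hvy]; omega
    · rw [if_pos hwz, if_pos hvw.symm]; omega
    · rw [if_pos hyz, if_pos hvy.symm]; omega
    · rw [if_pos hwz.symm, if_pos hyz.symm]; omega
  rcases hv with h1 | h1 <;> rcases hw with h2 | h2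
  · exact (cyclic_triangle hvw h1 h2).packs.mono (by grind)
  · exact (hfour hyz h1 h2 hvz hwy).packs
  · exact (hfour hyz.symm h1 h2 hvy hwz).packs.mono (by grind)
  · exact (cyclic_triangle hvw h1 h2).packs.mono (by grind)

lemma packs_top (h : 3 * j ≤ T.card) : Packs (⊤ : SimpleGraph V) T j := by
  induction j generalizing T with
  | zero => exact ⟨∅, by simp⟩
  | succ j ih =>
    obtain ⟨S, hST, hS⟩ := Finset.exists_subset_card_eq (show 3 ≤ T.card by omega)
    obtain ⟨a, b, c, hab, hac, hbc, rfl⟩ := Finset.card_eq_three.1 hS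
    have h1 := Finset.card_sdiff_add_card_eq_card hST
    exact (ih (show 3 * j ≤ (T \ {a, b, c}).card by omega)).add
      (cyclic_triangle (G := ⊤) hab hac hbc).packs Finset.sdiff_disjoint Finset.sdiff_subset hST

end Packs

section Optimal

variable [Fintype V]

/-- In a graph without `j + 1` disjoint cyclic sets, `R` is the complement of `j` disjoint cyclic
sets, as large as possible and then spanning as many edges as possible. -/
structure Optimal (G : SimpleGraph V) (j : ℕ) (R : Finset V) : Prop where
  not_packs : ¬ Packs G Finset.univ (j + 1)
  packs : Packs G Rᶜ j
  max : ∀ R', Packs G R'ᶜ j → R'.card < R.card ∨ R'.card = R.card ∧ degSum G R' ≤ degSum G R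

/-- `C` is a cyclic set which together with `j - 1` others packs the complement of `R`. -/
structure Side (G : SimpleGraph V) (j : ℕ) (R C : Finset V) : Prop where
  cyclic : Cyclic G C
  disjoint : Disjoint R C
  pos : 1 ≤ j
  packs : Packs G (R ∪ C)ᶜ (j - 1)

variable {G : SimpleGraph V} {j : ℕ} {R C : Finset V}

lemma exists_optimal {R₀ : Finset V} (h : ¬ Packs G Finset.univ (j + 1)) (h₀ : Packs G R₀ᶜ j) :
    ∃ R, Optimal G j R ∧ R₀.card ≤ R.card := by
  obtain ⟨R, hR, hmax⟩ := Finset.exists_max_image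
    (Finset.univ.filter fun R : Finset V => Packs G Rᶜ j) (fun R => toLex (R.card, degSum G R))
    ⟨R₀, by simpa using h₀⟩
  simp only [Finset.mem_filter, Finset.mem_univ, true_and, Prod.Lex.toLex_le_toLex] at hR hmax
  refine ⟨R, ⟨h, hR, hmax⟩, ?_⟩
  rcases hmax R₀ h₀ with h | h
  · exact h.le
  · exact h.1.le

namespace Optimal

lemma acyclic (hR : Optimal G j R) {S : Finset V} (hS : S ⊆ R) : ¬ Cyclic G S := fun h =>
  hR.not_packs (hR.packs.add h.packs (Finset.disjoint_left.2 fun _ hx hx' =>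
    Finset.mem_compl.1 hx (hS hx')) (Finset.subset_univ _) (Finset.subset_univ _))

lemma not_packs_two (hR : Optimal G j R) (hC : Side G j R C) {T T' : Finset V}
    (hT : T ⊆ R ∪ C) (hT' : T' ⊆ R ∪ C) (hd : Disjoint T T') (h : Packs G T 1)
    (h' : Packs G T' 1) : False := by
  have h2 := h.add h' hd hT hT'
  have h3 := hC.packs.add h2 disjoint_compl_left (Finset.subset_univ _) (Finset.subset_univ _)
  have := hC.pos
  exact hR.not_packs (by convert h3 using 1; omega)

lemma card_le (hR : Optimal G j R) (hC : Side G j R C) {S : Finset V} (hS : S ⊆ R ∪ C)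
    (h : Cyclic G S) : C.card ≤ S.card := by
  have h1 : Packs G ((R ∪ C) \ S)ᶜ (j - 1 + 1) :=
    hC.packs.add h.packs (Finset.disjoint_left.2 fun _ hx hx' => Finset.mem_compl.1 hx (hS hx'))
      (by grind [Finset.mem_compl]) (by grind [Finset.mem_compl])
  rw [Nat.sub_add_cancel hC.pos] at h1
  have h2 := Finset.card_sdiff_add_card_eq_card hS
  have h3 := Finset.card_union_of_disjoint hC.disjoint
  rcases hR.max _ h1 with h4 | h4 <;> omega

lemma degOn_eq_two (hR : Optimal G j R) (hC : Side G j R C) {p : V} (hp : p ∈ C) :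
    degOn G p C = 2 := by
  obtain ⟨c, hc, hmin⟩ := Finset.exists_min_image C (fun v => degOn G v C) hC.cyclic.1
  have h3 := hC.cyclic.three_le_card
  have hcard := Finset.card_erase_add_one hc
  have hac : ∀ S' ⊆ C.erase c, ¬ Cyclic G S' := by
    intro S' hS' hcyc
    have h1 := hR.card_le hC (hS'.trans ((Finset.erase_subset _ _).trans
      Finset.subset_union_right)) hcyc
    have h2 := Finset.card_le_card hS'
    omega
  have h4 := degSum_add_two_le (Finset.card_pos.1 (by omega)) hac
  have h5 := degSum_insert (G := G) (Finset.notMem_erase c C)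
  have h6 := degOn_insert_self (G := G) (v := c) (S := C.erase c)
  rw [Finset.insert_erase hc] at h5 h6
  have hc2 := hC.cyclic.2 c hc
  have h7 : C.card * degOn G c C ≤ degSum G C := by
    rw [← smul_eq_mul]
    exact Finset.card_nsmul_le_sum _ _ _ hmin
  have h8 : degOn G c C = 2 := by
    obtain ⟨d, hd⟩ := Nat.exists_eq_add_of_le hc2
    rw [hd] at h7
    have : d = 0 := by nlinarith
    omega
  have h9 := Finset.add_sum_erase C (fun v => degOn G v C) hp
  have h10 : (C.erase p).card * 2 ≤ ∑ v ∈ C.erase p, degOn G v C := by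
    rw [← smul_eq_mul]
    exact Finset.card_nsmul_le_sum _ _ _ fun v hv => hC.cyclic.2 v (Finset.mem_of_mem_erase hv)
  have h11 := Finset.card_erase_add_one hp
  have h12 := hC.cyclic.2 p hp
  unfold degSum at *
  omega

lemma degOn_le_two (hR : Optimal G j R) (hC : Side G j R C) (hcard : 4 ≤ C.card) {w : V}
    (hw : w ∈ R) : degOn G w C ≤ 2 := by
  by_contra! hdeg
  have hwC : w ∉ C := Finset.disjoint_left.1 hC.disjoint hw
  have hsub : ∀ S ⊆ C, insert w S ⊆ R ∪ C := fun S hS => by grind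
  by_cases hall : ∀ p ∈ C, G.Adj w p
  · obtain ⟨p, hp⟩ := hC.cyclic.1
    obtain ⟨q, hq, hpq⟩ := degOn_pos_iff.1 (show 0 < degOn G p C by
      rw [hR.degOn_eq_two hC hp]; omega)
    have h1 := hR.card_le hC (hsub {p, q} (by grind [Finset.mem_compl]))
      (cyclic_triangle (hall p hp) (hall q hq) hpq)
    have := Finset.card_le_three (a := w) (b := p) (c := q)
    omega
  · push Not at hall
    obtain ⟨p, hp, hwp⟩ := hall
    have hp2 := hR.degOn_eq_two hC hp
    obtain ⟨q, hq, hpq⟩ := degOn_pos_iff.1 (show 0 < degOn G p C by omega)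
    have hq2 := hR.degOn_eq_two hC hq
    have hq' : q ∈ C.erase p := Finset.mem_erase.2 ⟨hpq.ne', hq⟩
    have hC1 : insert p (C.erase p) = C := Finset.insert_erase hp
    have hC2 : insert q ((C.erase p).erase q) = C.erase p := Finset.insert_erase hq'
    have s1 := degSum_insert (G := G) (Finset.notMem_erase p C)
    have s2 := degSum_insert (G := G) (Finset.notMem_erase q (C.erase p))
    have s3 := degSum_insert (G := G) (a := w) (S := (C.erase p).erase q) (by simp [hwC])
    rw [hC1] at s1
    rw [hC2] at s2
    have d1 := degOn_erase (G := G) (v := p) hp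
    have d2 := degOn_erase (G := G) (v := q) hp
    have d3 := degOn_erase (G := G) (v := q) hq'
    have d4 := degOn_erase (G := G) (v := w) hp
    have d5 := degOn_erase (G := G) (v := w) hq'
    rw [if_neg (G.loopless.irrefl _)] at d1 d3
    rw [if_pos hpq.symm] at d2
    rw [if_neg hwp] at d4
    have d6 : (if G.Adj w q then 1 else 0) ≤ 1 := by split_ifs <;> omega
    have c1 := Finset.card_erase_add_one hp
    have c2 := Finset.card_erase_add_one hq'
    have c3 := Finset.card_insert_of_notMem (a := w) (s := (C.erase p).erase q) (by simp [hwC])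
    have hsum : degSum G C = C.card * 2 := by
      rw [← smul_eq_mul]
      exact Finset.sum_eq_card_nsmul fun v hv => hR.degOn_eq_two hC hv
    have := degSum_add_two_le (G := G) (Finset.insert_nonempty w ((C.erase p).erase q))
      (fun S hS hcyc => by
        have h1 := hR.card_le hC (hS.trans (hsub _ (by grind [Finset.mem_compl]))) hcyc
        have h2 := Finset.card_le_card hS
        omega)
    omega

lemma degOn_le_three (hR : Optimal G j R) (hC : Side G j R C) {w : V} (hw : w ∈ R) :
    degOn G w C ≤ 3 := by
  by_cases h : 4 ≤ C.card
  · exact (hR.degOn_le_two hC h hw).trans (by omega)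
  · exact degOn_le_card.trans (by omega)

lemma packs_swap (hC : Side G j R C) {a w : V} (ha : a ∈ C) (hw : w ∈ R)
    (hcyc : Cyclic G (insert w (C.erase a))) : Packs G (insert a (R.erase w))ᶜ j := by
  have hd := Finset.disjoint_left.1 hC.disjoint
  have h1 := hC.packs.add hcyc.packs (U := (insert a (R.erase w))ᶜ) (by
    rw [Finset.disjoint_left]; grind [Finset.mem_compl]) (by grind [Finset.mem_compl]) (by
    intro x hx
    have := @hd x
    have := @hd a
    grind [Finset.mem_compl])
  rwa [Nat.sub_add_cancel hC.pos] at h1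

lemma card_swap (hC : Side G j R C) {a w : V} (ha : a ∈ C) (hw : w ∈ R) :
    (insert a (R.erase w)).card = R.card := by
  have hd := Finset.disjoint_right.1 hC.disjoint ha
  rw [Finset.card_insert_of_notMem (by simp [hd]), Finset.card_erase_add_one hw]

lemma degSum_swap (hC : Side G j R C) {a w : V} (ha : a ∈ C) (hw : w ∈ R) :
    degSum G (insert a (R.erase w)) + 2 * degOn G w R =
      degSum G R + 2 * degOn G a (R.erase w) := by
  have hd := Finset.disjoint_right.1 hC.disjoint ha
  have h1 := degSum_insert (G := G) (a := a) (S := R.erase w) (by simp [hd])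
  have h2 := degSum_insert (G := G) (Finset.notMem_erase w R)
  have h3 := degOn_insert_self (G := G) (v := w) (S := R.erase w)
  rw [Finset.insert_erase hw] at h2 h3
  omega

lemma degOn_le_of_swap (hR : Optimal G j R) (hC : Side G j R C) {a w : V} (ha : a ∈ C)
    (hw : w ∈ R) (hcyc : Cyclic G (insert w (C.erase a))) :
    degOn G a (R.erase w) ≤ degOn G w R := by
  have h1 := card_swap hC ha hw
  have h2 := degSum_swap hC ha hw
  rcases hR.max _ (packs_swap hC ha hw hcyc) with h | h <;> omega

lemma swap (hR : Optimal G j R) (hC : Side G j R C) {a w : V} (ha : a ∈ C)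
    (hw : w ∈ R) (hcyc : Cyclic G (insert w (C.erase a)))
    (hle : degOn G w R ≤ degOn G a (R.erase w)) : Optimal G j (insert a (R.erase w)) := by
  have h1 := card_swap hC ha hw
  have h2 := degSum_swap hC ha hw
  refine ⟨hR.not_packs, packs_swap hC ha hw hcyc, fun R' hR' => ?_⟩
  rcases hR.max _ hR' with h | h
  · left; omega
  · right; omega

/-- The complement of an optimal set is exactly covered by disjoint cyclic sets. -/
lemma exists_family (hR : Optimal G j R) : ∃ F : Finset (Finset V), F.card = j ∧
    (∀ S ∈ F, Cyclic G S) ∧ (F : Set (Finset V)).PairwiseDisjoint id ∧ F.biUnion id = Rᶜ := by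
  obtain ⟨F, hF, hcyc, hdisj⟩ := hR.packs
  have hsub : F.biUnion id ⊆ Rᶜ := Finset.biUnion_subset.2 fun S hS => (hcyc S hS).2
  have h1 : Packs G ((F.biUnion id)ᶜ)ᶜ j :=
    ⟨F, hF, fun S hS => ⟨(hcyc S hS).1, by
      rw [compl_compl]; exact Finset.subset_biUnion_of_mem id hS⟩, hdisj⟩
  have h2 : R ⊆ (F.biUnion id)ᶜ := by
    intro x hx
    rw [Finset.mem_compl]
    exact fun hx' => Finset.mem_compl.1 (hsub hx') hx
  have h3 : R = (F.biUnion id)ᶜ := by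
    apply Finset.eq_of_subset_of_card_le h2
    rcases hR.max _ h1 with h | h <;> omega
  exact ⟨F, hF, fun S hS => (hcyc S hS).1, hdisj, by rw [h3, compl_compl]⟩

end Optimal

lemma packs_of_disjoint_family {F F' : Finset (Finset V)} (hcyc : ∀ S ∈ F, Cyclic G S)
    (hdisj : (F : Set (Finset V)).PairwiseDisjoint id) (hF : F.biUnion id = Rᶜ) (hF' : F' ⊆ F) :
    Packs G (R ∪ F'.biUnion id)ᶜ (F.card - F'.card) := by
  rw [← Finset.card_sdiff_of_subset hF']
  refine packs_of_family (fun S hS => ⟨hcyc S (Finset.mem_sdiff.1 hS).1, ?_⟩)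
    (hdisj.subset (by simp))
  intro x hx
  have hSF := (Finset.mem_sdiff.1 hS).1
  have h1 : x ∈ Rᶜ := hF ▸ Finset.mem_biUnion.2 ⟨S, hSF, hx⟩
  simp only [Finset.mem_compl, Finset.mem_union, Finset.mem_biUnion, id, not_or, not_exists,
    not_and] at h1 ⊢
  refine ⟨h1, fun S' hS' hx' => ?_⟩
  have hne : S ≠ S' := fun h => (Finset.mem_sdiff.1 hS).2 (h ▸ hS')
  exact Finset.disjoint_left.1 (hdisj hSF (hF' hS') hne) hx hx'

lemma side_of_mem {F : Finset (Finset V)} (hcyc : ∀ S ∈ F, Cyclic G S)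
    (hdisj : (F : Set (Finset V)).PairwiseDisjoint id) (hF : F.biUnion id = Rᶜ) (hC : C ∈ F) :
    Side G F.card R C := by
  refine ⟨hcyc C hC, ?_, Finset.card_pos.2 ⟨C, hC⟩, ?_⟩
  · rw [Finset.disjoint_right]
    intro x hx
    rw [← Finset.mem_compl, ← hF]
    exact Finset.mem_biUnion.2 ⟨C, hC, hx⟩
  · simpa using packs_of_disjoint_family hcyc hdisj hF (Finset.singleton_subset_iff.2 hC)

lemma degOn_univ_le {F : Finset (Finset V)} (hF : F.biUnion id = Rᶜ) (v : V) :
    degOn G v Finset.univ ≤ degOn G v R + ∑ C ∈ F, degOn G v C := by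
  have h1 : degOn G v Finset.univ ≤ degOn G v R + degOn G v (F.biUnion id) := by
    rw [hF]
    unfold degOn
    rw [← Finset.union_compl R, Finset.filter_union]
    exact Finset.card_union_le _ _
  have h2 : degOn G v (F.biUnion id) ≤ ∑ C ∈ F, degOn G v C := by
    unfold degOn
    rw [Finset.filter_biUnion]
    exact Finset.card_biUnion_le
  omega

end Optimal

section Leaves

variable [Fintype V] {G : SimpleGraph V} {j : ℕ} {R C : Finset V}

lemma Optimal.not_adj_of_swap (hR : Optimal G j R) (hC : Side G j R C) (h3 : C.card = 3)
    {a w w' : V} (ha : a ∈ C) (hw : w ∈ R) (hw' : w' ∈ R) (hne : w' ≠ w) (hdeg : degOn G w R ≤ 1)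
    (hadj : ∀ b ∈ C, b ≠ a → G.Adj w b) (haw' : G.Adj w' a) :
    degOn G w R = 1 ∧ ∀ x ∈ R, x ≠ w → x ≠ w' → ¬ G.Adj x a := by
  have h1 := hR.degOn_le_of_swap hC ha hw (hC.cyclic.swap h3 ha hadj)
  have hw'' : w' ∈ R.erase w := Finset.mem_erase.2 ⟨hne, hw'⟩
  have h2 : 0 < degOn G a (R.erase w) := degOn_pos_iff.2 ⟨w', hw'', haw'.symm⟩
  refine ⟨by omega, fun x hx hxw hxw' hadj => hxw' ?_⟩
  exact degOn_eq_one_unique (h1.trans hdeg) (Finset.mem_erase.2 ⟨hxw, hx⟩) hw'' hadj.symm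
    haw'.symm

/-- If two vertices of degree at most one in `R` send five edges to `C`, then `C` is a triangle,
both are leaves, and no other vertex of `R` has a neighbour in `C`. -/
lemma Optimal.leaf_pair (hR : Optimal G j R) (hC : Side G j R C) {u v : V} (hu : u ∈ R)
    (hv : v ∈ R) (huv : u ≠ v) (hdu : degOn G u R ≤ 1) (hdv : degOn G v R ≤ 1)
    (h : 5 ≤ degOn G u C + degOn G v C) :
    C.card = 3 ∧ degOn G u R = 1 ∧ degOn G v R = 1 ∧
      ∀ x ∈ R, x ≠ u → x ≠ v → degOn G x C = 0 := by
  have h3 : C.card = 3 := by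
    by_contra hne
    have h4 := hC.cyclic.three_le_card
    have h5 := hR.degOn_le_two hC (by omega) hu
    have h6 := hR.degOn_le_two hC (by omega) hv
    omega
  refine ⟨h3, ?_⟩
  wlog hfull : 3 ≤ degOn G u C generalizing u v
  · have h5 := hR.degOn_le_three hC hv
    obtain ⟨h6, h7, h8⟩ := this hv hu huv.symm hdv hdu (by omega) (by omega)
    exact ⟨h7, h6, fun x hx hxu hxv => h8 x hx hxv hxu⟩
  have hu3 : ∀ b ∈ C, G.Adj u b := fun b hb => adj_of_card_le_degOn (by omega) hb
  have hv2 : 2 ≤ degOn G v C := by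
    have := hR.degOn_le_three hC hu
    omega
  have key1 : ∀ a ∈ C, G.Adj v a → degOn G u R = 1 ∧ ∀ x ∈ R, x ≠ u → x ≠ v → ¬ G.Adj x a :=
    fun a ha hva => hR.not_adj_of_swap hC h3 ha hu hv huv.symm hdu (fun b hb _ => hu3 b hb) hva
  have key2 : ∀ a ∈ C, (∀ b ∈ C, b ≠ a → G.Adj v b) →
      degOn G v R = 1 ∧ ∀ x ∈ R, x ≠ v → x ≠ u → ¬ G.Adj x a :=
    fun a ha hva => hR.not_adj_of_swap hC h3 ha hv hu huv hdv hva (hu3 a ha)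
  have key3 : ∀ a ∈ C, ¬ G.Adj v a → ∀ b ∈ C, b ≠ a → G.Adj v b := fun a ha hva b hb hab =>
    adj_of_not_adj_of_ne (by omega) ha hva hb hab
  refine ⟨?_, ?_, fun x hx hxu hxv => ?_⟩
  · obtain ⟨a, ha, hva⟩ := degOn_pos_iff.1 (show 0 < degOn G v C by omega)
    exact (key1 a ha hva).1
  · by_cases hall : ∃ a ∈ C, ¬ G.Adj v a
    · obtain ⟨a, ha, hva⟩ := hall
      exact (key2 a ha (key3 a ha hva)).1
    · push Not at hall
      obtain ⟨a, ha⟩ := hC.cyclic.1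
      exact (key2 a ha fun b hb _ => hall b hb).1
  · by_contra hpos
    obtain ⟨a, ha, hxa⟩ := degOn_pos_iff.1 (Nat.pos_of_ne_zero hpos)
    by_cases hva : G.Adj v a
    · exact (key1 a ha hva).2 x hx hxu hxv hxa
    · exact (key2 a ha (key3 a ha hva)).2 x hx hxv hxu hxa

/-- Four vertices of a path sending nine edges to a triangle leave room for two cycles. -/
lemma Optimal.degOn_path_le (hR : Optimal G j R) (hC : Side G j R C) {u u' v' v : V}
    (hu : u ∈ R) (hu' : u' ∈ R) (hv' : v' ∈ R) (hv : v ∈ R) (huu' : G.Adj u u')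
    (hvv' : G.Adj v v') (huv : u ≠ v) (huv' : u ≠ v') (hvu' : v ≠ u') (huv'' : u' ≠ v')
    (h3 : C.card = 3) (h : degOn G u C + degOn G v C ≤ 4) :
    degOn G u C + degOn G v C + degOn G u' C + degOn G v' C ≤ 8 := by
  by_contra! h9
  wlog hfull : 3 ≤ degOn G u' C generalizing u u' v v'
  · exact this hv hv' hu' hu hvv' huu' huv.symm hvu' huv' huv''.symm (by omega) (by omega)
      (by have := hR.degOn_le_three hC hv'; omega)
  have hv'3 := hR.degOn_le_three hC hv'
  have hu'3 := hR.degOn_le_three hC hu'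
  have hd := Finset.disjoint_left.1 hC.disjoint
  have hu'all : ∀ b ∈ C, G.Adj u' b := fun b hb => adj_of_card_le_degOn (by omega) hb
  -- no edge from `u` to `C` can leave an edge from `v` to the rest of `C`
  have key : ∀ a ∈ C, G.Adj u a → ∀ b ∈ C, b ≠ a → ¬ G.Adj v b := by
    intro a ha hua b hb hba hvb
    obtain ⟨y, z, rfl, hay, haz, hyz⟩ := hC.cyclic.exists_triangle h3 ha
    have hv'y : G.Adj v' y ∨ G.Adj v' z := by
      by_contra! hcon
      exact hcon.2 (adj_of_not_adj_of_ne (S := {a, y, z}) (by omega) (by simp) hcon.1 (by simp)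
        hyz.ne')
    have hvy : G.Adj v y ∨ G.Adj v z := by
      simp only [Finset.mem_insert, Finset.mem_singleton] at hb
      rcases hb with rfl | rfl | rfl
      · exact absurd rfl hba
      · exact Or.inl hvb
      · exact Or.inr hvb
    have hdu := hd hu
    have hdv := hd hv
    have hdu' := hd hu'
    have hdv' := hd hv'
    simp only [Finset.mem_insert, Finset.mem_singleton, not_or] at hdu hdv hdu' hdv'
    refine hR.not_packs_two hC (T := {u, u', a}) (T' := {v, v', y, z}) (by grind) (by grind) ?_
      (cyclic_triangle huu' hua (hu'all a ha)).packs
      (packs_two_edges hvv' hyz hvy hv'y hdv.2.1 hdv.2.2 hdv'.2.1 hdv'.2.2)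
    have := hay.ne
    have := haz.ne
    rw [Finset.disjoint_left]
    grind
  have hzero : degOn G u C = 0 ∨ degOn G v C = 0 := by
    by_contra! hcon
    obtain ⟨a, ha, hua⟩ := degOn_pos_iff.1 (Nat.pos_of_ne_zero hcon.1)
    obtain ⟨b, hb, hvb⟩ := degOn_pos_iff.1 (Nat.pos_of_ne_zero hcon.2)
    have hba : b = a := by
      by_contra hne
      exact key a ha hua b hb hne hvb
    subst hba
    have huone : degOn G u C ≤ 1 := by
      unfold degOn
      rw [Finset.card_le_one]
      intro x hx y hy
      rw [Finset.mem_filter] at hx hy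
      by_contra hxy
      by_cases hxb : b = x
      · exact key y hy.1 hy.2 b hb (fun h => hxy (hxb.symm.trans h)) hvb
      · exact key x hx.1 hx.2 b hb hxb hvb
    have hvone : degOn G v C ≤ 1 := by
      unfold degOn
      rw [Finset.card_le_one]
      intro x hx y hy
      rw [Finset.mem_filter] at hx hy
      by_contra hxy
      by_cases hxb : x = b
      · exact key b hb hua y hy.1 (fun h => hxy (hxb.trans h.symm)) hy.2
      · exact key b hb hua x hx.1 hxb hx.2
    omega
  have hu3 := hR.degOn_le_three hC hu
  have hv3 := hR.degOn_le_three hC hv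
  have hv'all : ∀ b ∈ C, G.Adj v' b := fun b hb => adj_of_card_le_degOn (by omega) hb
  -- a path vertex adjacent to all of `C` yields two disjoint triangles
  have fin : ∀ {x x' y' : V}, x ∈ R → x' ∈ R → y' ∈ R → G.Adj x x' → x ≠ y' → x' ≠ y' →
      (∀ b ∈ C, G.Adj x' b) → (∀ b ∈ C, G.Adj y' b) → ¬ 3 ≤ degOn G x C := by
    intro x x' y' hx hx' hy' hxx' hxy' hx'y' hx'all hy'all hge
    have hxall : ∀ b ∈ C, G.Adj x b := fun b hb => adj_of_card_le_degOn (by omega) hb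
    obtain ⟨a, ha⟩ := hC.cyclic.1
    obtain ⟨y, z, rfl, hay, haz, hyz⟩ := hC.cyclic.exists_triangle h3 ha
    have hdx := hd hx
    have hdx' := hd hx'
    have hdy' := hd hy'
    simp only [Finset.mem_insert, Finset.mem_singleton, not_or] at hdx hdx' hdy'
    refine hR.not_packs_two hC (T := {x, x', a}) (T' := {y', y, z}) (by grind) (by grind) ?_
      (cyclic_triangle hxx' (hxall a ha) (hx'all a ha)).packs
      (cyclic_triangle (hy'all y (by simp)) (hy'all z (by simp)) hyz).packs
    have := hay.ne
    have := haz.ne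
    rw [Finset.disjoint_left]
    grind
  rcases hzero with h0 | h0
  · exact fin hv hv' hu' hvv' hvu' huv''.symm hv'all hu'all (by omega)
  · exact fin hu hu' hv' huu' huv' huv'' hu'all hv'all (by omega)

end Leaves

section MinDegree

variable [Fintype V] {G : SimpleGraph V} {j : ℕ} {R C : Finset V}

/-- If the vertices of `T` send few edges to `R`, then they send many edges to one of the cyclic
sets outside of `R`. -/
lemma Optimal.exists_side (hR : Optimal G j R)
    (hmin : ∀ v, 2 * (j + 1) ≤ degOn G v Finset.univ) (T : Finset V) (c : ℕ)
    (h : ∑ t ∈ T, degOn G t R + j * c < T.card * (2 * (j + 1))) :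
    ∃ C, Side G j R C ∧ c < ∑ t ∈ T, degOn G t C := by
  obtain ⟨F, hFj, hcyc, hdisj, hF⟩ := hR.exists_family
  have h1 : T.card * (2 * (j + 1)) ≤ ∑ t ∈ T, (degOn G t R + ∑ C ∈ F, degOn G t C) := by
    rw [← smul_eq_mul]
    exact Finset.card_nsmul_le_sum _ _ _ fun t _ => (hmin t).trans (degOn_univ_le hF t)
  rw [Finset.sum_add_distrib, Finset.sum_comm] at h1
  have h2 : ∑ C ∈ F, c < ∑ C ∈ F, ∑ t ∈ T, degOn G t C := by
    rw [Finset.sum_const, hFj, smul_eq_mul]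
    omega
  obtain ⟨C, hC, hlt⟩ := Finset.exists_lt_of_sum_lt h2
  exact ⟨C, hFj ▸ side_of_mem hcyc hdisj hF hC, hlt⟩

lemma Optimal.exists_side_pair (hR : Optimal G j R)
    (hmin : ∀ v, 2 * (j + 1) ≤ degOn G v Finset.univ) {u v : V} (huv : u ≠ v)
    (hu : degOn G u R ≤ 1) (hv : degOn G v R ≤ 1) :
    ∃ C, Side G j R C ∧ 5 ≤ degOn G u C + degOn G v C := by
  obtain ⟨C, hC, h⟩ := hR.exists_side hmin {u, v} 4 (by
    rw [Finset.sum_pair huv, Finset.card_pair huv]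
    omega)
  rw [Finset.sum_pair huv] at h
  exact ⟨C, hC, h⟩

lemma Optimal.degOn_pos (hR : Optimal G j R)
    (hmin : ∀ v, 2 * (j + 1) ≤ degOn G v Finset.univ) (hcard : 3 ≤ R.card) {w : V} (hw : w ∈ R) :
    0 < degOn G w R := by
  by_contra! h0
  have hne : (R.erase w).Nonempty := by
    rw [← Finset.card_pos, Finset.card_erase_of_mem hw]
    omega
  have hac := hR.acyclic (Finset.erase_subset w R)
  simp only [Cyclic, hne, true_and, not_forall, not_le] at hac
  obtain ⟨w', hw', hdeg⟩ := hac
  rw [Finset.mem_erase] at hw'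
  have h1 : degOn G w' R ≤ 1 := by
    rw [degOn_erase hw, if_neg]
    · omega
    · exact fun h => absurd (degOn_pos_iff.2 ⟨w', hw'.2, h.symm⟩) (by omega)
  obtain ⟨C, hC, h5⟩ := hR.exists_side_pair hmin hw'.1 h1 (by omega)
  have := (hR.leaf_pair hC hw'.2 hw hw'.1 h1 (by omega) h5).2.2.1
  omega

lemma Optimal.eq_or_eq_of_leaves (hR : Optimal G j R)
    (hmin : ∀ v, 2 * (j + 1) ≤ degOn G v Finset.univ) {u v t : V} (hu : u ∈ R) (hv : v ∈ R)
    (ht : t ∈ R) (huv : u ≠ v) (hdu : degOn G u R ≤ 1) (hdv : degOn G v R ≤ 1)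
    (hdt : degOn G t R ≤ 1) : t = u ∨ t = v := by
  by_contra! hne
  have hsum : ∀ f : V → ℕ, ∑ x ∈ {u, v, t}, f x = f u + f v + f t := fun f => by
    rw [Finset.sum_insert (by simp [huv, hne.1.symm]), Finset.sum_pair hne.2.symm, add_assoc]
  obtain ⟨C, hC, h⟩ := hR.exists_side hmin {u, v, t} 6 (by
    rw [hsum, Finset.card_eq_three.2 ⟨u, v, t, huv, hne.1.symm, hne.2.symm, rfl⟩]
    omega)
  rw [hsum] at h
  have h1 := hR.degOn_le_three hC hu
  have h2 := hR.degOn_le_three hC hv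
  have h3 := hR.degOn_le_three hC ht
  by_cases h4 : 5 ≤ degOn G u C + degOn G v C
  · have := (hR.leaf_pair hC hu hv huv hdu hdv h4).2.2.2 t ht hne.1 hne.2
    omega
  by_cases h5 : 5 ≤ degOn G u C + degOn G t C
  · have := (hR.leaf_pair hC hu ht hne.1.symm hdu hdt h5).2.2.2 v hv huv.symm hne.2.symm
    omega
  by_cases h6 : 5 ≤ degOn G v C + degOn G t C
  · have := (hR.leaf_pair hC hv ht hne.2.symm hdv hdt h6).2.2.2 u hu huv hne.1.symm
    omega
  omega

lemma Optimal.exists_leaves (hR : Optimal G j R)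
    (hmin : ∀ v, 2 * (j + 1) ≤ degOn G v Finset.univ) (hcard : 3 ≤ R.card) :
    ∃ u ∈ R, ∃ v ∈ R, u ≠ v ∧ degOn G u R = 1 ∧ degOn G v R = 1 ∧
      ∀ x ∈ R, x ≠ u → x ≠ v → degOn G x R = 2 := by
  have hpos : ∀ w ∈ R, 0 < degOn G w R := fun w hw => hR.degOn_pos hmin hcard hw
  have hsum := degSum_add_two_le (Finset.card_pos.1 (by omega)) fun S => hR.acyclic (S := S)
  have hsplit := Finset.sum_filter_add_sum_filter_not R (fun w => degOn G w R ≤ 1)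
    (fun w => degOn G w R)
  have hcsplit := Finset.card_filter_add_card_filter_not (s := R) (fun w => degOn G w R ≤ 1)
  have h1 : (R.filter fun w => degOn G w R ≤ 1).card * 1 ≤
      ∑ w ∈ R with degOn G w R ≤ 1, degOn G w R := by
    rw [← smul_eq_mul]
    exact Finset.card_nsmul_le_sum _ _ _ fun w hw => hpos w (Finset.mem_filter.1 hw).1
  have h2 : (R.filter fun w => ¬ degOn G w R ≤ 1).card * 2 ≤
      ∑ w ∈ R with ¬ degOn G w R ≤ 1, degOn G w R := by
    rw [← smul_eq_mul]
    exact Finset.card_nsmul_le_sum _ _ _ fun w hw => not_le.1 (Finset.mem_filter.1 hw).2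
  unfold degSum at hsum
  obtain ⟨u, hu, v, hv, huv⟩ := Finset.one_lt_card.1
    (show 1 < (R.filter fun w => degOn G w R ≤ 1).card by omega)
  rw [Finset.mem_filter] at hu hv
  have hu1 : degOn G u R = 1 := le_antisymm hu.2 (hpos u hu.1)
  have hv1 : degOn G v R = 1 := le_antisymm hv.2 (hpos v hv.1)
  refine ⟨u, hu.1, v, hv.1, huv, hu1, hv1, ?_⟩
  have hv' : v ∈ R.erase u := Finset.mem_erase.2 ⟨huv.symm, hv.1⟩
  have hle : ∀ x ∈ (R.erase u).erase v, 2 ≤ degOn G x R := by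
    intro x hx
    simp only [Finset.mem_erase] at hx
    by_contra! hlt
    rcases hR.eq_or_eq_of_leaves hmin hu.1 hv.1 hx.2.2 huv hu.2 hv.2 (by omega) with h | h
    · exact hx.2.1 h
    · exact hx.1 h
  have hs1 := Finset.add_sum_erase R (fun w => degOn G w R) hu.1
  have hs2 := Finset.add_sum_erase (R.erase u) (fun w => degOn G w R) hv'
  have hc1 := Finset.card_erase_add_one hu.1
  have hc2 := Finset.card_erase_add_one hv'
  have heq := (Finset.sum_eq_sum_iff_of_le hle).1 (le_antisymm (Finset.sum_le_sum hle) (by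
    rw [Finset.sum_const, smul_eq_mul]
    omega))
  exact fun x hx hxu hxv => (heq x (by simp [hx, hxu, hxv])).symm

/-- An optimal set in a graph of large minimum degree spans a path on three vertices. -/
lemma Optimal.exists_path (hR : Optimal G j R)
    (hmin : ∀ v, 2 * (j + 1) ≤ degOn G v Finset.univ) (hcard : 3 ≤ R.card) :
    ∃ u m v, R = {u, m, v} ∧ G.Adj u m ∧ G.Adj v m ∧ u ≠ v ∧ ¬ G.Adj u v := by
  obtain ⟨u, hu, v, hv, huv, hdu, hdv, htwo⟩ := hR.exists_leaves hmin hcard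
  obtain ⟨u', hu', huu'⟩ := degOn_pos_iff.1 (show 0 < degOn G u R by omega)
  obtain ⟨v', hv', hvv'⟩ := degOn_pos_iff.1 (show 0 < degOn G v R by omega)
  have hNu : ∀ x ∈ R, G.Adj u x → x = u' := fun x hx h =>
    degOn_eq_one_unique hdu.le hx hu' h huu'
  have hNv : ∀ x ∈ R, G.Adj v x → x = v' := fun x hx h =>
    degOn_eq_one_unique hdv.le hx hv' h hvv'
  have hclosed : ∀ S ⊆ R, u ∉ S → v ∉ S → (∀ x ∈ S, ∀ w ∈ R, w ∉ S → ¬ G.Adj x w) → S = ∅ := by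
    intro S hS huS hvS h
    by_contra hne
    refine hR.acyclic hS ⟨Finset.nonempty_iff_ne_empty.2 hne, fun x hx => ?_⟩
    rw [degOn_eq_of_not_adj hS (h x hx), htwo x (hS hx) (fun h => huS (h ▸ hx))
      (fun h => hvS (h ▸ hx))]
  have hnuv : ¬ G.Adj u v := by
    intro hadj
    have h1 := hNu v hv hadj
    have h2 := hNv u hu hadj.symm
    have h3 := hclosed (R \ {u, v}) (by grind) (by simp) (by simp) (by
      intro x hx w hw hwS hxw
      have : w = u ∨ w = v := by grind
      rcases this with rfl | rfl
      · have := hNu x (by grind) hxw.symm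
        grind
      · have := hNv x (by grind) hxw.symm
        grind)
    have h4 : R ⊆ {u, v} := Finset.sdiff_eq_empty_iff_subset.1 h3
    have := Finset.card_le_card h4
    rw [Finset.card_pair huv] at this
    omega
  have hvu' : v ≠ u' := fun h => hnuv (h ▸ huu')
  have huv' : u ≠ v' := fun h => hnuv (h ▸ hvv').symm
  by_cases huv'' : u' = v'
  · subst huv''
    refine ⟨u, u', v, ?_, huu', hvv', huv, hnuv⟩
    have h3 := hclosed (R \ {u, u', v}) (by grind) (by simp) (by simp) (by
      intro x hx w hw hwS hxw
      rw [Finset.mem_sdiff] at hx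
      have : w = u ∨ w = u' ∨ w = v := by grind
      rcases this with rfl | rfl | rfl
      · have := hNu x hx.1 hxw.symm
        grind
      · have h1 := htwo w hu' huu'.ne' hvv'.ne'
        have hxu : u ≠ x := by grind
        have hxv : v ≠ x := by grind
        have h2 := degOn_mono (G := G) (v := w) (show {u, v, x} ⊆ R by grind)
        rw [degOn_triple huv hxu hxv, if_pos huu'.symm, if_pos hvv'.symm, if_pos hxw.symm] at h2
        omega
      · have := hNv x hx.1 hxw.symm
        grind)
    exact (Finset.sdiff_eq_empty_iff_subset.1 h3).antisymm (by grind)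
  · exfalso
    have hsum : ∀ f : V → ℕ, ∑ x ∈ {u, v, u', v'}, f x = f u + (f v + (f u' + f v')) := fun f => by
      rw [Finset.sum_insert (by simp [huv, huu'.ne, huv']),
        Finset.sum_insert (by simp [hvu', hvv'.ne]), Finset.sum_pair huv'']
    have h4 : ({u, v, u', v'} : Finset V).card = 4 := by
      rw [Finset.card_eq_sum_ones, hsum]
    have hu'2 := htwo u' hu' huu'.ne' hvu'.symm
    have hv'2 := htwo v' hv' huv'.symm hvv'.ne'
    obtain ⟨C, hC, h⟩ := hR.exists_side hmin {u, v, u', v'} 8 (by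
      rw [hsum, h4]
      omega)
    rw [hsum] at h
    by_cases h5 : 5 ≤ degOn G u C + degOn G v C
    · have h6 := (hR.leaf_pair hC hu hv huv hdu.le hdv.le h5).2.2.2
      have h7 := h6 u' hu' huu'.ne' hvu'.symm
      have h8 := h6 v' hv' huv'.symm hvv'.ne'
      have := hR.degOn_le_three hC hu
      have := hR.degOn_le_three hC hv
      omega
    · by_cases h3 : C.card = 3
      · have := hR.degOn_path_le hC hu hu' hv' hv huu' hvv' huv huv' hvu' huv'' h3 (by omega)
        omega
      · have h9 := hC.cyclic.three_le_card
        have := hR.degOn_le_two hC (by omega) hu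
        have := hR.degOn_le_two hC (by omega) hv
        have := hR.degOn_le_two hC (by omega) hu'
        have := hR.degOn_le_two hC (by omega) hv'
        omega

end MinDegree

section ThreeVertexPath

variable [Fintype V] {G : SimpleGraph V} {j : ℕ} {C : Finset V}

lemma Optimal.path_ends_le (hR : Optimal G j {a, m, b}) (hC : Side G j {a, m, b} C)
    (ham : a ≠ m) (hmb : m ≠ b) (hab : a ≠ b) (hnab : ¬ G.Adj a b) :
    degOn G m C = 0 ∨ degOn G a C + degOn G b C ≤ 4 := by
  by_contra! h
  refine h.1 ((hR.leaf_pair hC (u := a) (v := b) (by simp) (by simp) hab ?_ ?_ (by omega)).2.2.2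
    m (by simp) ham.symm hmb)
  · rw [degOn_triple ham hab hmb, if_neg (G.loopless.irrefl a), if_neg hnab]
    split_ifs <;> omega
  · rw [degOn_triple ham hab hmb, if_neg (G.loopless.irrefl b), if_neg fun h => hnab h.symm]
    split_ifs <;> omega

/-- Three disjoint triangles in the union of two triangles and a path `umv`. -/
lemma Optimal.degOn_eq_zero_of_full {R U : Finset V} (hR : Optimal G j R) (hj : 2 ≤ j)
    (hP : Packs G Uᶜ (j - 2)) (hC : Cyclic G C) (hC3 : C.card = 3) (hCU : C ⊆ U)
    {u m v x y z : V} (hsub : {u, m, v, x, y, z} ⊆ U) (hd : Disjoint {u, m, v, x, y, z} C)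
    (hT : Cyclic G {v, x, y}) (huz : G.Adj u z) (hum : u ≠ m)
    (hdT : Disjoint {u, m, z} ({v, x, y} : Finset V)) (hmz : m ≠ z)
    (hu : 3 ≤ degOn G u C) (hm : 3 ≤ degOn G m C) : degOn G z C = 0 := by
  by_contra hz
  obtain ⟨p, hp, hzp⟩ := degOn_pos_iff.1 (Nat.pos_of_ne_zero hz)
  have hu' : ∀ b ∈ C, G.Adj u b := fun b hb => adj_of_card_le_degOn (by omega) hb
  have hm' : ∀ b ∈ C, G.Adj m b := fun b hb => adj_of_card_le_degOn (by omega) hb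
  obtain ⟨q, r, rfl, hpq, hpr, hqr⟩ := hC.exists_triangle hC3 hp
  have hpq' := hpq.ne
  have hpr' := hpr.ne
  have huz' := huz.ne
  have h1 : Packs G {m, q, r} 1 :=
    (cyclic_triangle (hm' q (by simp)) (hm' r (by simp)) hqr).packs
  have h2 : Packs G {u, z, p} 1 := (cyclic_triangle huz (hu' p hp) hzp).packs
  simp only [Finset.disjoint_left, Finset.mem_insert, Finset.mem_singleton, not_or] at hd hdT
  have h3 : Packs G ({v, x, y, m, q, r} : Finset V) (1 + 1) := by
    refine hT.packs.add h1 ?_ (by grind) (by grind)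
    rw [Finset.disjoint_left]
    grind
  have h4 : Packs G ({v, x, y, m, q, r, u, z, p} : Finset V) (1 + 1 + 1) := by
    refine h3.add h2 ?_ (by grind) (by grind)
    rw [Finset.disjoint_left]
    grind
  have h5 := hP.add h4 (U := Finset.univ)
    (Finset.disjoint_of_subset_right (by
      simp only [Finset.insert_subset_iff, Finset.singleton_subset_iff] at hsub hCU ⊢
      tauto) disjoint_compl_left) (Finset.subset_univ _) (Finset.subset_univ _)
  exact hR.not_packs (by convert h5 using 1; omega)

lemma side_of_disjoint_union {R S T : Finset V} (hC : Cyclic G C) (hT : Cyclic G T)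
    (hRT : R ∪ T = S) (hRT' : Disjoint R T) (hd : Disjoint S C) (hj : 2 ≤ j)
    (hP : Packs G (S ∪ C)ᶜ (j - 2)) : Side G j R C := by
  subst hRT
  refine ⟨hC, Finset.disjoint_of_subset_left Finset.subset_union_left hd, by omega, ?_⟩
  have hdT := Finset.disjoint_left.1 (Finset.disjoint_of_subset_left Finset.subset_union_right hd)
  have h1 := hP.add hT.packs (U := (R ∪ C)ᶜ)
    (Finset.disjoint_of_subset_right (by grind) disjoint_compl_left)
    (Finset.compl_subset_compl.2 (by grind)) fun w hw => by
      have h2 := hdT hw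
      have h3 := Finset.disjoint_right.1 hRT' hw
      simp [h2, h3]
  convert h1 using 1
  omega

/-- The weighted number of edges from a cyclic set `C` to a path `umv` and a triangle `xyz` such
that `u` and `v` can be exchanged with `y` and `z`, respectively. -/
lemma Optimal.weight_le {u m v x y z : V} (hR : Optimal G j {u, m, v})
    (hRy : Optimal G j {m, v, y}) (hRz : Optimal G j {m, u, z}) (hC : Side G j {u, m, v} C)
    (hj : 2 ≤ j)
    (hP : Packs G ({u, m, v, x, y, z} ∪ C)ᶜ (j - 2)) (hd : Disjoint {u, m, v, x, y, z} C)
    (hnd : [u, m, v, x, y, z].Nodup) (hnuv : ¬ G.Adj u v) (hnmy : ¬ G.Adj m y)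
    (hnmz : ¬ G.Adj m z) (hvy : G.Adj v y) (huz : G.Adj u z)
    (hT : Cyclic G {v, x, y}) (hT' : Cyclic G {u, x, z}) :
    degOn G u C + degOn G v C + 2 * degOn G m C + degOn G y C + degOn G z C ≤ 12 := by
  simp only [List.nodup_cons, List.mem_cons, List.not_mem_nil, or_false, not_or] at hnd
  obtain ⟨⟨hum, huv, hux, huy, -⟩, ⟨hmv, hmx, hmy, hmz⟩, ⟨hvx, -, hvz⟩, ⟨hxy, hxz⟩, hyz, -⟩ := hnd
  have hCy : Side G j {m, v, y} C := by
    refine side_of_disjoint_union hC.cyclic hT' ?_ ?_ hd hj hP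
    · grind
    · rw [Finset.disjoint_left]
      grind
  have hCz : Side G j {m, u, z} C := by
    refine side_of_disjoint_union hC.cyclic hT ?_ ?_ hd hj hP
    · grind
    · rw [Finset.disjoint_left]
      grind
  have h1 := hR.path_ends_le hC hum hmv huv hnuv
  have h2 := hRy.path_ends_le hCy hmv hvy.ne hmy hnmy
  have h3 := hRz.path_ends_le hCz (Ne.symm hum) huz.ne hmz hnmz
  have hu3 := hR.degOn_le_three hC (w := u) (by simp)
  have hm3 := hR.degOn_le_three hC (w := m) (by simp)
  have hv3 := hR.degOn_le_three hC (w := v) (by simp)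
  have hy3 := hRy.degOn_le_three hCy (w := y) (by simp)
  have hz3 := hRz.degOn_le_three hCz (w := z) (by simp)
  by_contra! hlt
  have hC3 : C.card = 3 := by
    by_contra hne
    have h4 := hC.cyclic.three_le_card
    have := hR.degOn_le_two hC (by omega) (w := u) (by simp)
    have := hR.degOn_le_two hC (by omega) (w := m) (by simp)
    have := hR.degOn_le_two hC (by omega) (w := v) (by simp)
    omega
  have h4 : 3 ≤ degOn G u C → 3 ≤ degOn G m C → degOn G z C = 0 :=
    hR.degOn_eq_zero_of_full hj hP hC.cyclic hC3 Finset.subset_union_right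
      Finset.subset_union_left hd hT huz hum (by
        simp only [Finset.disjoint_left, Finset.mem_insert, Finset.mem_singleton]
        grind) hmz
  have hperm : ({v, m, u, x, z, y} : Finset V) = {u, m, v, x, y, z} := by grind
  have h5 : 3 ≤ degOn G v C → 3 ≤ degOn G m C → degOn G y C = 0 :=
    hR.degOn_eq_zero_of_full hj hP hC.cyclic hC3 Finset.subset_union_right
      (hperm ▸ Finset.subset_union_left) (hperm ▸ hd) hT' hvy (Ne.symm hmv) (by
        simp only [Finset.disjoint_left, Finset.mem_insert, Finset.mem_singleton]
        grind) hmy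
  omega

/-- A path `umv` cannot be optimal if `u` is adjacent to all of a triangle `A` to which `v` sends
two edges and `m` none. -/
lemma Optimal.false_of_triangle {u m v : V} (hR : Optimal G j {u, m, v})
    (hmin : ∀ v, 2 * (j + 1) ≤ degOn G v Finset.univ) (hum : G.Adj u m) (hvm : G.Adj v m)
    (huv : u ≠ v) (hnuv : ¬ G.Adj u v) {F : Finset (Finset V)} (hFj : F.card = j)
    (hcyc : ∀ S ∈ F, Cyclic G S) (hdisj : (F : Set (Finset V)).PairwiseDisjoint id)
    (hF : F.biUnion id = {u, m, v}ᶜ) {A : Finset V} (hA : A ∈ F) (hA3 : A.card = 3)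
    (hu : 3 ≤ degOn G u A) (hv : 2 ≤ degOn G v A) (hmA : degOn G m A = 0) : False := by
  have hside : ∀ C ∈ F, Side G j {u, m, v} C := fun C hC =>
    hFj ▸ side_of_mem hcyc hdisj hF hC
  have hSA := hside A hA
  have hu3 := hR.degOn_le_three hSA (w := u) (by simp)
  have hv3 := hR.degOn_le_three hSA (w := v) (by simp)
  have hdu : degOn G u {u, m, v} = 1 := by
    simp [degOn_triple hum.ne huv hvm.ne', hum, hnuv]
  have hdv : degOn G v {u, m, v} = 1 := by
    simp [degOn_triple hum.ne huv hvm.ne', hvm, G.adj_comm v u, hnuv]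
  have hdm : degOn G m {u, m, v} = 2 := by
    simp [degOn_triple hum.ne huv hvm.ne', hum.symm, hvm.symm]
  have hdeg : ∀ w, 2 * (j + 1) ≤ degOn G w {u, m, v} + ∑ C ∈ F, degOn G w C := fun w =>
    (hmin w).trans (degOn_univ_le hF w)
  obtain ⟨z, hz, hvz⟩ : ∃ z ∈ A, ∀ b ∈ A, b ≠ z → G.Adj v b := by
    by_cases hall : ∃ z ∈ A, ¬ G.Adj v z
    · obtain ⟨z, hz, hvz⟩ := hall
      exact ⟨z, hz, fun b hb hbz => adj_of_not_adj_of_ne (by omega) hz hvz hb hbz⟩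
    · push Not at hall
      obtain ⟨z, hz⟩ := hSA.cyclic.1
      exact ⟨z, hz, fun b hb _ => hall b hb⟩
  have hua : ∀ b ∈ A, G.Adj u b := fun b hb => adj_of_card_le_degOn (by omega) hb
  have hma : ∀ b ∈ A, ¬ G.Adj m b := fun b hb h => by
    have := degOn_pos_iff.2 ⟨b, hb, h⟩
    omega
  obtain ⟨x, y, hAeq, hzx, hzy, hxy⟩ := hSA.cyclic.exists_triangle hA3 hz
  have hx : x ∈ A := by simp [hAeq]
  have hy : y ∈ A := by simp [hAeq]
  have hvx := hvz x hx hzx.ne'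
  have hvy := hvz y hy hzy.ne'
  have huA : u ∉ A := Finset.disjoint_left.1 hSA.disjoint (by simp)
  have hmA' : m ∉ A := Finset.disjoint_left.1 hSA.disjoint (by simp)
  have hvA : v ∉ A := Finset.disjoint_left.1 hSA.disjoint (by simp)
  have hnd : [u, m, v, x, y, z].Nodup := by
    have := hum.ne
    have := hvm.ne
    have := hzx.ne
    have := hzy.ne
    have := hxy.ne
    simp only [List.nodup_cons, List.mem_cons, List.not_mem_nil, or_false, not_or]
    grind
  have hT : Cyclic G {v, x, y} := cyclic_triangle hvx hvy hxy
  have hT' : Cyclic G {u, x, z} := cyclic_triangle (hua x hx) (hua z hz) hzx.symm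
  have hAy : A.erase y = {x, z} := by grind
  have hAz : A.erase z = {x, y} := by grind
  have hRu : ({u, m, v} : Finset V).erase u = {m, v} := by grind
  have hRv : ({u, m, v} : Finset V).erase v = {m, u} := by grind
  have hRy : Optimal G j {m, v, y} := by
    have h1 := hR.swap hSA hy (w := u) (by simp) (by rwa [hAy]) (by
      rw [hdu, hRu]
      exact degOn_pos_iff.2 ⟨v, by simp, hvy.symm⟩)
    rw [hRu] at h1
    convert h1 using 1
    grind
  have hRz : Optimal G j {m, u, z} := by
    have h1 := hR.swap hSA hz (w := v) (by simp) (by rwa [hAz]) (by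
      rw [hdv, hRv]
      exact degOn_pos_iff.2 ⟨u, by simp, (hua z hz).symm⟩)
    rw [hRv] at h1
    convert h1 using 1
    grind
  have hweight : ∀ C ∈ F.erase A,
      degOn G u C + degOn G v C + 2 * degOn G m C + degOn G y C + degOn G z C ≤ 12 := by
    intro C hC
    obtain ⟨hCA, hCF⟩ := Finset.mem_erase.1 hC
    have hSC := hside C hCF
    have hdCA : Disjoint C A := hdisj hCF hA hCA
    have hj : 2 ≤ j := by
      rw [← hFj]
      exact Finset.one_lt_card.2 ⟨C, hCF, A, hA, hCA⟩
    have hd : Disjoint {u, m, v, x, y, z} C := by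
      have h1 := Finset.disjoint_left.1 hSC.disjoint
      have h2 := Finset.disjoint_right.1 hdCA
      rw [Finset.disjoint_left]
      grind
    have hP : Packs G ({u, m, v, x, y, z} ∪ C)ᶜ (j - 2) := by
      have h1 := packs_of_disjoint_family hcyc hdisj hF
        (F' := {C, A}) (Finset.insert_subset hCF (Finset.singleton_subset_iff.2 hA))
      rw [Finset.card_pair hCA, hFj] at h1
      convert h1 using 2
      rw [Finset.biUnion_insert, Finset.singleton_biUnion]
      grind
    exact hR.weight_le hRy hRz hSC hj hP hd hnd hnuv (hma y hy) (hma z hz) hvy (hua z hz) hT hT'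
  have hsum := Finset.sum_le_card_nsmul _ _ _ hweight
  simp only [Finset.sum_add_distrib, ← Finset.mul_sum, smul_eq_mul] at hsum
  have hsplit : ∀ w, degOn G w A + ∑ C ∈ F.erase A, degOn G w C = ∑ C ∈ F, degOn G w C :=
    fun w => Finset.add_sum_erase F (fun C => degOn G w C) hA
  have hcard := Finset.card_erase_add_one hA
  have hyR : degOn G y {u, m, v} ≤ 2 := by
    rw [degOn_triple hum.ne huv hvm.ne', if_neg (show ¬ G.Adj y m from fun h => hma y hy h.symm)]
    split_ifs <;> omega
  have hzR : degOn G z {u, m, v} ≤ 2 := by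
    rw [degOn_triple hum.ne huv hvm.ne', if_neg (show ¬ G.Adj z m from fun h => hma z hz h.symm)]
    split_ifs <;> omega
  have hyA := hR.degOn_eq_two hSA hy
  have hzA := hR.degOn_eq_two hSA hz
  have := hdeg u
  have := hdeg v
  have := hdeg m
  have := hdeg y
  have := hdeg z
  have := hsplit u
  have := hsplit v
  have := hsplit m
  have := hsplit y
  have := hsplit z
  omega

lemma Optimal.false_of_path {u m v : V} (hR : Optimal G j {u, m, v})
    (hmin : ∀ v, 2 * (j + 1) ≤ degOn G v Finset.univ) (hum : G.Adj u m) (hvm : G.Adj v m)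
    (huv : u ≠ v) (hnuv : ¬ G.Adj u v) : False := by
  obtain ⟨F, hFj, hcyc, hdisj, hF⟩ := hR.exists_family
  have hdu : degOn G u {u, m, v} = 1 := by
    simp [degOn_triple hum.ne huv hvm.ne', hum, hnuv]
  have hdv : degOn G v {u, m, v} = 1 := by
    simp [degOn_triple hum.ne huv hvm.ne', hvm, G.adj_comm v u, hnuv]
  obtain ⟨A, hA, hA5⟩ : ∃ A ∈ F, 4 < degOn G u A + degOn G v A := by
    have h1 : ∑ C ∈ F, 4 < ∑ C ∈ F, (degOn G u C + degOn G v C) := by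
      have := (hmin u).trans (degOn_univ_le hF u)
      have := (hmin v).trans (degOn_univ_le hF v)
      rw [Finset.sum_const, smul_eq_mul, Finset.sum_add_distrib]
      omega
    exact Finset.exists_lt_of_sum_lt h1
  have hSA : Side G j {u, m, v} A := hFj ▸ side_of_mem hcyc hdisj hF hA
  have hu3 := hR.degOn_le_three hSA (w := u) (by simp)
  have hv3 := hR.degOn_le_three hSA (w := v) (by simp)
  obtain ⟨hA3, -, -, hA0⟩ := hR.leaf_pair hSA (by simp) (by simp) huv hdu.le hdv.le hA5
  have hmA := hA0 m (by simp) hum.ne' hvm.ne'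
  by_cases hu : 3 ≤ degOn G u A
  · exact hR.false_of_triangle hmin hum hvm huv hnuv hFj hcyc hdisj hF hA hA3 hu (by omega) hmA
  · have hperm : ({u, m, v} : Finset V) = {v, m, u} := by grind
    rw [hperm] at hR hF
    exact hR.false_of_triangle hmin hvm hum huv.symm (fun h => hnuv h.symm) hFj hcyc hdisj hF hA
      hA3 (by omega) (by omega) hmA

end ThreeVertexPath

section Main

variable [Fintype V]

lemma Optimal.card_lt_three {G : SimpleGraph V} {j : ℕ} {R : Finset V} (hR : Optimal G j R)
    (hmin : ∀ v, 2 * (j + 1) ≤ degOn G v Finset.univ) : R.card < 3 := by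
  by_contra! hcard
  obtain ⟨u, m, v, rfl, hum, hvm, huv, hnuv⟩ := hR.exists_path hmin hcard
  exact hR.false_of_path hmin hum hvm huv hnuv

lemma packs_univ (G : SimpleGraph V) {j : ℕ} (hcard : 3 * (j + 1) ≤ Fintype.card V)
    (hmin : ∀ v, 2 * (j + 1) ≤ degOn G v Finset.univ) : Packs G Finset.univ (j + 1) := by
  induction G using WellFoundedGT.induction with
  | ind G ih =>
    by_contra hnot
    have hne : G ≠ ⊤ := by
      rintro rfl
      exact hnot (packs_top hcard)
    obtain ⟨x, y, hxy, hnadj⟩ := SimpleGraph.ne_top_iff_exists_not_adj.1 hne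
    have hlt : G < G ⊔ SimpleGraph.edge x y := by
      refine lt_of_le_of_ne le_sup_left fun h => hnadj ?_
      rw [h]
      exact Or.inr ((SimpleGraph.edge_adj _ _ _ _).2 ⟨Or.inl ⟨rfl, rfl⟩, hxy⟩)
    obtain ⟨F, hF, hcyc, hdisj⟩ := ih _ hlt fun v => (hmin v).trans
      (degOn_mono_adj fun w _ h => hlt.le h)
    have hcycG : ∀ S ∈ F, ¬ (x ∈ S ∧ y ∈ S) → Cyclic G S := by
      intro S hS hxyS
      refine ⟨(hcyc S hS).1.1, fun v hv => ((hcyc S hS).1.2 v hv).trans ?_⟩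
      refine degOn_mono_adj fun w hw hvw => ?_
      rw [SimpleGraph.sup_adj, SimpleGraph.edge_adj] at hvw
      refine hvw.resolve_right ?_
      rintro ⟨⟨rfl, rfl⟩ | ⟨rfl, rfl⟩, -⟩
      · exact hxyS ⟨hv, hw⟩
      · exact hxyS ⟨hw, hv⟩
    by_cases hex : ∃ S ∈ F, x ∈ S ∧ y ∈ S
    · obtain ⟨S, hS, hxS, -⟩ := hex
      have h1 : Packs G Sᶜ (F.erase S).card := by
        refine packs_of_family (fun S' hS' => ?_) (hdisj.subset (by simp))
        obtain ⟨hne, hS'⟩ := Finset.mem_erase.1 hS'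
        have hd : Disjoint S' S := hdisj hS' hS hne
        exact ⟨hcycG S' hS' fun h => Finset.disjoint_left.1 hd h.1 hxS,
          Finset.subset_compl_iff_disjoint_right.2 hd⟩
      rw [Finset.card_erase_of_mem hS, hF, Nat.add_sub_cancel] at h1
      obtain ⟨R, hR, hle⟩ := exists_optimal hnot h1
      have := (hcyc S hS).1.three_le_card
      have := hR.card_lt_three hmin
      omega
    · exact hnot ⟨F, hF, fun S hS => ⟨hcycG S hS fun h => hex ⟨S, hS, h⟩,
        Finset.subset_univ _⟩, hdisj⟩

end Main

end CorradiHajnal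

/-- Corrádi–Hajnal: a graph with at least `3k` vertices and minimum degree at least `2k`
contains `k` vertex-disjoint cycles. -/
theorem corradi_hajnal {V : Type*} [Fintype V] (G : SimpleGraph V) [DecidableRel G.Adj]
    (k : ℕ) (hk : 1 ≤ k) (hcard : 3 * k ≤ Fintype.card V)
    (hdeg : ∀ v : V, 2 * k ≤ G.degree v) :
    HasDisjointCycles G k := by
  classical
  obtain ⟨j, rfl⟩ : ∃ j, k = j + 1 := ⟨k - 1, by omega⟩
  apply CorradiHajnal.Packs.exists_cycles (T := Finset.univ)
  apply CorradiHajnal.packs_univ G hcard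
  intro v
  convert hdeg v using 1
  rw [← SimpleGraph.card_neighborFinset_eq_degree, SimpleGraph.neighborFinset_eq_filter,
    CorradiHajnal.degOn]
  congr!
end

section
/- Let k ≥ 3 and let G be a graph in which the number of vertices of degree at least 2k exceeds the number of vertices of degree at most 2k−2 by at least k² + 2k − 4. Then G contains k vertex-disjoint cycles. -/
/-- `H_k(G)`: the set of vertices of degree at least `2k`. -/
def highSet {V : Type*} [Fintype V] (G : SimpleGraph V) [DecidableRel G.Adj] (k : ℕ) :
    Finset V :=
  Finset.univ.filter fun v => 2 * k ≤ G.degree v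

/-- `L_k(G)`: the set of vertices of degree at most `2k - 2`. -/
def lowSet {V : Type*} [Fintype V] (G : SimpleGraph V) [DecidableRel G.Adj] (k : ℕ) :
    Finset V :=
  Finset.univ.filter fun v => G.degree v ≤ 2 * k - 2

open scoped Classical in
/-- The number of neighbours of `v` in `S`. -/
noncomputable def SimpleGraph.degreeIn {V : Type*} (G : SimpleGraph V) (S : Finset V) (v : V) : ℕ :=
  (S.filter (G.Adj v)).card

/-- A nonempty set of vertices inducing a subgraph of minimum degree at least two. -/
def SimpleGraph.IsCore {V : Type*} (G : SimpleGraph V) (C : Finset V) : Prop :=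
  C.Nonempty ∧ ∀ v ∈ C, 2 ≤ G.degreeIn C v

/-- `S` contains `k` pairwise disjoint cores of `G`. -/
def SimpleGraph.HasCorePacking {V : Type*} (G : SimpleGraph V) (S : Finset V) (k : ℕ) : Prop :=
  ∃ c : Fin k → Finset V, (∀ i, c i ⊆ S ∧ G.IsCore (c i)) ∧ ∀ i j, i ≠ j → Disjoint (c i) (c j)

/-- The sign of a vertex of degree `d`: `1` if it is high, `-1` if it is low, `0` otherwise. -/
def degreeSign (k d : ℕ) : ℤ :=
  if 2 * k ≤ d then 1 else if d + 2 ≤ 2 * k then -1 else 0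

/-- The number of high vertices minus the number of low vertices of the graph induced on `S`. -/
noncomputable def SimpleGraph.excess {V : Type*} (G : SimpleGraph V) (k : ℕ) (S : Finset V) : ℤ :=
  ∑ v ∈ S, degreeSign k (G.degreeIn S v)

theorem degreeSign_le_one (k d : ℕ) : degreeSign k d ≤ 1 := by
  unfold degreeSign; split_ifs <;> omega

namespace SimpleGraph
variable {V : Type*} {G : SimpleGraph V} {S C T : Finset V} {k : ℕ}

open scoped Classical in
theorem degreeIn_mono (h : C ⊆ S) (v : V) : G.degreeIn C v ≤ G.degreeIn S v :=
  Finset.card_le_card (Finset.filter_subset_filter _ h)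

open scoped Classical in
theorem degreeIn_sdiff_add (h : C ⊆ S) (v : V) :
    G.degreeIn (S \ C) v + G.degreeIn C v = G.degreeIn S v := by
  unfold degreeIn
  rw [← Finset.card_union_of_disjoint, ← Finset.filter_union, Finset.sdiff_union_of_subset h]
  exact Finset.disjoint_filter_filter Finset.sdiff_disjoint

open scoped Classical in
theorem degreeIn_insert {x : V} (h : x ∉ C) (v : V) :
    G.degreeIn (insert x C) v = G.degreeIn C v + if G.Adj v x then 1 else 0 := by
  unfold degreeIn
  rw [Finset.filter_insert]
  split_ifs <;> simp [h]

@[simp] theorem degreeIn_empty (v : V) : G.degreeIn ∅ v = 0 := by simp [degreeIn]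

open scoped Classical in
theorem sum_degreeIn_comm (A B : Finset V) :
    ∑ v ∈ A, G.degreeIn B v = ∑ v ∈ B, G.degreeIn A v := by
  simp only [degreeIn, Finset.card_filter]
  rw [Finset.sum_comm]
  simp only [G.adj_comm]

open scoped Classical in
theorem degreeIn_le_card (S : Finset V) (v : V) : G.degreeIn S v ≤ S.card :=
  Finset.card_filter_le _ _

open scoped Classical in
/-- A set without cores induces a forest, so it spans fewer edges than it has vertices. -/
theorem sum_degreeIn_add_two_le (hS : S.Nonempty) (h : ∀ C ⊆ S, ¬ G.IsCore C) :
    ∑ v ∈ S, G.degreeIn S v + 2 ≤ 2 * S.card := by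
  induction hn : S.card generalizing S with
  | zero => simp_all
  | succ n ih =>
    obtain ⟨v, hv, hd⟩ : ∃ v ∈ S, G.degreeIn S v ≤ 1 := by
      by_contra! hc
      exact h S subset_rfl ⟨hS, hc⟩
    have hcard : (S.erase v).card = n := by rw [Finset.card_erase_of_mem hv, hn]; rfl
    have hins : insert v (S.erase v) = S := Finset.insert_erase hv
    have hsum : ∑ w ∈ S, G.degreeIn S w =
        ∑ w ∈ S.erase v, G.degreeIn (S.erase v) w + 2 * G.degreeIn S v := by
      have hw (w : V) : G.degreeIn S w = G.degreeIn (S.erase v) w + G.degreeIn {v} w := by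
        rw [Finset.erase_eq, degreeIn_sdiff_add (by simpa using hv)]
      have hvv : G.degreeIn {v} v = 0 := by simp [degreeIn, Finset.filter_singleton]
      rw [← Finset.add_sum_erase _ _ hv, Finset.sum_congr rfl fun w _ => hw w,
        Finset.sum_add_distrib, sum_degreeIn_comm _ {v}, Finset.sum_singleton, hw v, hvv]
      ring
    rcases (S.erase v).eq_empty_or_nonempty with he | he
    · have : G.degreeIn S v = 0 := by
        rw [← hins, he]; simp [degreeIn, Finset.filter_singleton]
      rw [hsum, he, this]; simp
    · have := ih he (fun C hC => h C (hC.trans (Finset.erase_subset _ _))) hcard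
      omega

open scoped Classical in
theorem HasCorePacking.of_sdiff (hC : G.IsCore C) (hCS : C ⊆ S) (h : G.HasCorePacking (S \ C) k) :
    G.HasCorePacking S (k + 1) := by
  obtain ⟨c, hc, hd⟩ := h
  have hdis (i : Fin k) : Disjoint C (c i) :=
    Finset.disjoint_of_subset_right (hc i).1 Finset.disjoint_sdiff
  refine ⟨Fin.cons C c, fun i => ?_, fun i j hij => ?_⟩
  · cases i using Fin.cases with
    | zero => exact ⟨hCS, hC⟩
    | succ i => exact ⟨(hc i).1.trans Finset.sdiff_subset, (hc i).2⟩
  · cases i using Fin.cases <;> cases j using Fin.cases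
    · exact absurd rfl hij
    · exact hdis _
    · exact (hdis _).symm
    · exact hd _ _ fun h => hij (congrArg _ h)

theorem hasCorePacking_zero : G.HasCorePacking S 0 :=
  ⟨Fin.elim0, fun i => i.elim0, fun i => i.elim0⟩

open scoped Classical in
theorem HasCorePacking.of_isCore (hC : G.IsCore C) (hCS : C ⊆ S) : G.HasCorePacking S 1 :=
  .of_sdiff hC hCS hasCorePacking_zero

theorem degreeIn_congr {G' : SimpleGraph V} {v : V} (h : ∀ w ∈ S, G.Adj v w ↔ G'.Adj v w) :
    G.degreeIn S v = G'.degreeIn S v := by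
  classical
  exact congrArg _ (Finset.filter_congr h)

theorem degreeIn_le_of_le {G' : SimpleGraph V} (h : G ≤ G') (v : V) :
    G.degreeIn S v ≤ G'.degreeIn S v := by
  classical
  exact Finset.card_le_card (Finset.monotone_filter_right _ fun w _ hw => h hw)

theorem HasCorePacking.mono_left {G' : SimpleGraph V} (hG : G ≤ G') (hS : C ⊆ S)
    (h : G.HasCorePacking C k) : G'.HasCorePacking S k := by
  obtain ⟨c, hc, hd⟩ := h
  refine ⟨c, fun i => ⟨(hc i).1.trans hS, (hc i).2.1, fun v hv => ((hc i).2.2 v hv).trans ?_⟩, hd⟩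
  exact degreeIn_le_of_le hG v

open scoped Classical in
theorem isCore_triple {x y z : V} (hxy : G.Adj x y) (hyz : G.Adj y z) (hxz : G.Adj x z) :
    G.IsCore {x, y, z} := by
  refine ⟨by simp, fun v hv => ?_⟩
  have := hxy.ne; have := hyz.ne; have := hxz.ne
  simp only [Finset.mem_insert, Finset.mem_singleton] at hv
  rcases hv with rfl | rfl | rfl <;>
    simp [degreeIn, Finset.filter_insert, Finset.filter_singleton, G.adj_comm, *, hxy.symm,
      hyz.symm, hxz.symm]

theorem not_isAcyclic_of_forall_two_le_degree [Fintype V] [Nonempty V] [DecidableRel G.Adj]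
    (h : ∀ v, 2 ≤ G.degree v) : ¬ G.IsAcyclic := by
  intro hG
  obtain ⟨u, v, p, hp, hmax⟩ := Walk.exists_isPath_forall_isPath_length_le_length G
  have hw : ∀ w ∈ G.neighborFinset u, w = p.snd := by
    intro w hw
    rw [mem_neighborFinset] at hw
    by_cases hws : w ∈ p.support
    · exact hG.eq_snd_of_adj_start hp hw hws
    · have := hmax _ _ _ (hp.cons (h := hw.symm) hws)
      simp at this
  have := Finset.card_le_one.2 fun a ha b hb => (hw a ha).trans (hw b hb).symm
  rw [card_neighborFinset_eq_degree] at this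
  exact absurd (h u) (by omega)

theorem IsCore.exists_isCycle (hC : G.IsCore C) :
    ∃ (v : V) (p : G.Walk v v), p.IsCycle ∧ ∀ w ∈ p.support, w ∈ C := by
  classical
  have : Nonempty C := hC.1.to_subtype
  have hdeg (v : C) : 2 ≤ (G.induce (C : Set V)).degree v := by
    refine (hC.2 v v.2).trans ?_
    rw [← card_neighborFinset_eq_degree, degreeIn,
      ← Finset.card_map (Function.Embedding.subtype (· ∈ (C : Set V)))]
    refine Finset.card_le_card fun w hw => ?_
    simpa [and_comm] using hw
  have h := not_isAcyclic_of_forall_two_le_degree hdeg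
  simp only [IsAcyclic, not_forall, not_not] at h
  obtain ⟨v, p, hp⟩ := h
  let f := Embedding.induce (G := G) (C : Set V)
  refine ⟨f v, p.map f.toHom, hp.map f.injective, fun w hw => ?_⟩
  simp only [Walk.support_map, List.mem_map] at hw
  obtain ⟨u, -, rfl⟩ := hw
  exact u.2

/-- The graph obtained from `G` by joining `y` to all neighbours of `x`. Away from `x` this is the
contraction of the pair `x`, `y`. -/
def mergeInto (G : SimpleGraph V) (x y : V) : SimpleGraph V :=
  G ⊔ fromRel fun a b => a = y ∧ G.Adj x b

theorem mergeInto_adj {x y v w : V} :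
    (G.mergeInto x y).Adj v w ↔
      G.Adj v w ∨ v ≠ w ∧ (v = y ∧ G.Adj x w ∨ w = y ∧ G.Adj x v) := by
  simp [mergeInto, fromRel_adj]

theorem degreeIn_mergeInto_of_ne {x y v : V} (hy : y ∉ C) (hv : v ≠ y) :
    (G.mergeInto x y).degreeIn C v = G.degreeIn C v := by
  refine degreeIn_congr fun w hw => ?_
  have : w ≠ y := fun h => hy (h ▸ hw)
  simp [mergeInto_adj, hv, this]

theorem degreeIn_mergeInto_self_eq_card {x y : V} (hy : y ∉ C) :
    open scoped Classical in
    (G.mergeInto x y).degreeIn C y = (C.filter (G.Adj y) ∪ C.filter (G.Adj x)).card := by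
  classical
  unfold degreeIn
  rw [← Finset.filter_or]
  refine congrArg _ (Finset.filter_congr fun w hw => ?_)
  have : w ≠ y := fun h => hy (h ▸ hw)
  simp [mergeInto_adj, this, this.symm]

theorem degreeIn_mergeInto_self_le {x y : V} (hy : y ∉ C) :
    (G.mergeInto x y).degreeIn C y ≤ G.degreeIn C y + G.degreeIn C x := by
  classical
  rw [degreeIn_mergeInto_self_eq_card hy]
  exact Finset.card_union_le _ _

theorem degreeIn_mergeInto_self {x y : V} (hy : y ∉ C)
    (h : ∀ w ∈ C, G.Adj y w → ¬ G.Adj x w) :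
    (G.mergeInto x y).degreeIn C y = G.degreeIn C y + G.degreeIn C x := by
  classical
  rw [degreeIn_mergeInto_self_eq_card hy, Finset.card_union_of_disjoint]
  · rfl
  · exact Finset.disjoint_filter.2 h

theorem degreeIn_pos_of_adj {v w : V} (hw : w ∈ C) (h : G.Adj v w) : 0 < G.degreeIn C v := by
  classical
  exact Finset.card_pos.2 ⟨w, Finset.mem_filter.2 ⟨hw, h⟩⟩

theorem IsCore.of_mergeInto {x y : V} (hxy : G.Adj x y) (hx : x ∉ C)
    (hC : (G.mergeInto x y).IsCore C) :
    open scoped Classical in ∃ D ⊆ insert x C, G.IsCore D ∧ (x ∈ D → y ∈ C) := by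
  classical
  by_cases hy : y ∈ C
  swap
  · refine ⟨C, Finset.subset_insert _ _, ⟨hC.1, fun v hv => ?_⟩, fun h => absurd h hx⟩
    rw [← degreeIn_mergeInto_of_ne (x := x) hy fun h => hy (h ▸ hv)]
    exact hC.2 v hv
  obtain ⟨R, hyR, rfl⟩ : ∃ R, y ∉ R ∧ insert y R = C :=
    ⟨C.erase y, Finset.notMem_erase _ _, Finset.insert_erase hy⟩
  obtain ⟨hxy', hxR⟩ : x ≠ y ∧ x ∉ R := by simpa using hx
  have hself : 2 ≤ G.degreeIn R y + G.degreeIn R x := by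
    have := hC.2 y hy
    rw [degreeIn_insert hyR, if_neg ((G.mergeInto x y).irrefl)] at this
    exact this.trans (degreeIn_mergeInto_self_le hyR)
  have hne {v : V} (hv : v ∈ R) : v ≠ y := fun h => hyR (h ▸ hv)
  have hR {v : V} (hv : v ∈ R) :
      2 ≤ G.degreeIn R v + if G.Adj v y ∨ G.Adj v x then 1 else 0 := by
    have := hC.2 v (Finset.mem_insert_of_mem hv)
    rw [degreeIn_insert hyR, degreeIn_mergeInto_of_ne hyR (hne hv)] at this
    simpa [mergeInto_adj, hne hv, G.adj_comm] using this
  have hadj {u v : V} (hu : G.degreeIn R u = 0) (hv : v ∈ R) : ¬ G.Adj v u := fun h =>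
    (degreeIn_pos_of_adj hv h.symm).ne' hu
  by_cases hb : G.degreeIn R x = 0
  · refine ⟨insert y R, Finset.subset_insert _ _, ⟨by simp, fun v hv => ?_⟩, fun _ => hy⟩
    rw [degreeIn_insert hyR]
    rcases Finset.mem_insert.1 hv with rfl | hv
    · omega
    · simpa [hadj hb hv] using hR hv
  by_cases ha : G.degreeIn R y = 0
  · refine ⟨insert x R, Finset.insert_subset_insert _ (Finset.subset_insert _ _),
      ⟨by simp, fun v hv => ?_⟩, fun _ => hy⟩
    rw [degreeIn_insert hxR]
    rcases Finset.mem_insert.1 hv with rfl | hv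
    · omega
    · simpa [hadj ha hv] using hR hv
  · refine ⟨insert x (insert y R), subset_rfl, ⟨by simp, fun v hv => ?_⟩, fun _ => hy⟩
    rw [degreeIn_insert hx, degreeIn_insert hyR]
    simp only [Finset.mem_insert] at hv
    rcases hv with rfl | rfl | hv
    · rw [if_pos hxy]; omega
    · rw [if_pos hxy.symm]; omega
    · have := hR hv
      split_ifs at this ⊢ <;> simp_all

theorem HasCorePacking.of_mergeInto {x y : V} (hxy : G.Adj x y) (hx : x ∉ S)
    (h : (G.mergeInto x y).HasCorePacking S k) :
    open scoped Classical in G.HasCorePacking (insert x S) k := by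
  classical
  obtain ⟨c, hc, hd⟩ := h
  choose D hD hcore hxD using fun i => (hc i).2.of_mergeInto hxy fun h => hx ((hc i).1 h)
  refine ⟨D, fun i => ⟨(hD i).trans (Finset.insert_subset_insert _ (hc i).1), hcore i⟩,
    fun i j hij => Finset.disjoint_left.2 fun v hvi hvj => ?_⟩
  have hdis := Finset.disjoint_left.1 (hd i j hij)
  rcases eq_or_ne v x with rfl | hv
  · exact hdis (hxD i hvi) (hxD j hvj)
  · exact hdis (Finset.mem_of_mem_insert_of_ne (hD i hvi) hv)
      (Finset.mem_of_mem_insert_of_ne (hD j hvj) hv)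

theorem excess_eq_card (h : ∀ v ∈ S, 2 * k ≤ G.degreeIn S v) : G.excess k S = S.card := by
  rw [excess, Finset.sum_congr rfl fun v hv => show degreeSign k (G.degreeIn S v) = 1 from
    if_pos (h v hv)]
  simp

open scoped Classical in
theorem excess_insert_le {v : V} (hk : 2 ≤ k) (hv : v ∉ C)
    (hd : G.degreeIn (insert v C) v ≤ 1) : G.excess k (insert v C) ≤ G.excess k C := by
  rw [degreeIn_insert hv, if_neg G.irrefl, add_zero] at hd
  unfold excess
  rw [Finset.sum_insert hv, degreeIn_insert hv, if_neg G.irrefl, add_zero]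
  have h0 : degreeSign k (G.degreeIn C v) = -1 := by
    unfold degreeSign; split_ifs <;> omega
  have h1 (w : V) : degreeSign k (G.degreeIn (insert v C) w) ≤
      degreeSign k (G.degreeIn C w) + (G.degreeIn {v} w : ℕ) := by
    have : G.degreeIn {v} w = if G.Adj w v then 1 else 0 := by
      rw [← insert_empty_eq, degreeIn_insert (by simp), degreeIn_empty, zero_add]
    rw [degreeIn_insert hv, this]
    unfold degreeSign
    split_ifs <;> push_cast <;> omega
  have h2 := Finset.sum_le_sum fun w (_ : w ∈ C) => h1 w
  rw [Finset.sum_add_distrib, ← Nat.cast_sum, sum_degreeIn_comm, Finset.sum_singleton] at h2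
  omega

theorem degreeIn_deleteEdges_of_ne {x y v : V} (hx : v ≠ x) (hy : v ≠ y) :
    (G.deleteEdges {s(x, y)}).degreeIn S v = G.degreeIn S v :=
  degreeIn_congr fun w _ => by simp [deleteEdges_adj, hx, hy]

theorem degreeIn_deleteEdges_self {x y : V} (hxy : G.Adj x y) (hy : y ∈ S) :
    (G.deleteEdges {s(x, y)}).degreeIn S x + 1 = G.degreeIn S x := by
  classical
  unfold degreeIn
  rw [← Finset.card_erase_add_one (s := S.filter (G.Adj x)) (a := y) (by simp [hy, hxy])]
  congr 2
  ext w
  have := hxy.ne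
  simp only [Finset.mem_filter, Finset.mem_erase, deleteEdges_adj]
  aesop

theorem degreeIn_deleteEdges_self' {x y : V} (hxy : G.Adj x y) (hx : x ∈ S) :
    (G.deleteEdges {s(x, y)}).degreeIn S y + 1 = G.degreeIn S y := by
  rw [Sym2.eq_swap]
  exact degreeIn_deleteEdges_self hxy.symm hx

theorem sum_degreeIn_deleteEdges_lt {x y : V} (hxy : G.Adj x y) (hx : x ∈ S) (hy : y ∈ S) :
    ∑ v ∈ S, (G.deleteEdges {s(x, y)}).degreeIn S v < ∑ v ∈ S, G.degreeIn S v :=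
  Finset.sum_lt_sum (fun v _ => degreeIn_le_of_le (deleteEdges_le _) v)
    ⟨x, hx, by rw [← degreeIn_deleteEdges_self hxy hy]; exact Nat.lt_succ_self _⟩

/-- Deleting an edge lowers the sign of an endpoint only when that endpoint has degree
`2 * k - 1` or `2 * k`. -/
theorem excess_le_excess_deleteEdges {x y : V} (hxy : G.Adj x y) (hx : x ∈ S) (hy : y ∈ S)
    (hdx : G.degreeIn S x + 2 ≤ 2 * k ∨ 2 * k < G.degreeIn S x)
    (hdy : G.degreeIn S y + 2 ≤ 2 * k ∨ 2 * k < G.degreeIn S y) :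
    G.excess k S ≤ (G.deleteEdges {s(x, y)}).excess k S := by
  have key {d e : ℕ} (h : d + 1 = e) (he : e + 2 ≤ 2 * k ∨ 2 * k < e) :
      degreeSign k e ≤ degreeSign k d := by
    unfold degreeSign; split_ifs <;> omega
  refine Finset.sum_le_sum fun v _ => ?_
  rcases eq_or_ne v x with rfl | hvx
  · exact key (degreeIn_deleteEdges_self hxy hy) hdx
  rcases eq_or_ne v y with rfl | hvy
  · exact key (degreeIn_deleteEdges_self' hxy hx) hdy
  · rw [degreeIn_deleteEdges_of_ne hvx hvy]

open scoped Classical in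
/-- The excess after contracting an edge `x y` that lies in no triangle. -/
theorem excess_mergeInto {x y : V} (hxy : G.Adj x y) (hy : y ∉ C) (hx : x ∉ insert y C)
    (h : ∀ w ∈ C, G.Adj y w → ¬ G.Adj x w) :
    (G.mergeInto x y).excess k (insert y C) +
        degreeSign k (G.degreeIn (insert x (insert y C)) x) +
        degreeSign k (G.degreeIn (insert x (insert y C)) y) =
      G.excess k (insert x (insert y C)) +
        degreeSign k (G.degreeIn (insert x (insert y C)) y +
          G.degreeIn (insert x (insert y C)) x - 2) := by
  have hsum : ∑ w ∈ C, degreeSign k ((G.mergeInto x y).degreeIn (insert y C) w) =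
      ∑ w ∈ C, degreeSign k (G.degreeIn (insert x (insert y C)) w) := by
    refine Finset.sum_congr rfl fun w hw => congrArg _ ?_
    have hwy : w ≠ y := fun e => hy (e ▸ hw)
    rw [degreeIn_insert hy, degreeIn_insert hx, degreeIn_insert hy,
      degreeIn_mergeInto_of_ne hy hwy]
    have := h w hw
    rw [G.adj_comm y, G.adj_comm x] at this
    simp only [mergeInto_adj, hwy, G.adj_comm x w]
    split_ifs <;> simp_all
  unfold excess
  rw [Finset.sum_insert hx, Finset.sum_insert hy, Finset.sum_insert hy, hsum]
  have hdy : (G.mergeInto x y).degreeIn (insert y C) y =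
      G.degreeIn (insert x (insert y C)) y + G.degreeIn (insert x (insert y C)) x - 2 := by
    rw [degreeIn_insert hy, degreeIn_mergeInto_self hy h, if_neg (SimpleGraph.irrefl _),
      degreeIn_insert hx, degreeIn_insert hx, degreeIn_insert hy, degreeIn_insert hy,
      if_pos hxy, if_pos hxy.symm, if_neg G.irrefl, if_neg G.irrefl]
    omega
  rw [hdy]
  ring

/-- The excess that forces `k` disjoint cores. -/
def packingThreshold (k : ℕ) : ℤ :=
  if k = 2 then 6 else (k : ℤ) ^ 2 + 2 * k - 4

/-- A vertex- and edge-minimal pair `G`, `S` with large excess but without `k` disjoint cores. -/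
structure IsMinCounterexample (G : SimpleGraph V) (S : Finset V) (k : ℕ) : Prop where
  two_le : 2 ≤ k
  threshold_le : packingThreshold k ≤ G.excess k S
  not_hasCorePacking : ¬ G.HasCorePacking S k
  of_card_lt : ∀ (G' : SimpleGraph V) (S' : Finset V) (k' : ℕ), S'.card < S.card → 2 ≤ k' →
    packingThreshold k' ≤ G'.excess k' S' → G'.HasCorePacking S' k'
  of_sum_lt : ∀ G' : SimpleGraph V, ∑ v ∈ S, G'.degreeIn S v < ∑ v ∈ S, G.degreeIn S v →
    packingThreshold k ≤ G'.excess k S → G'.HasCorePacking S k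

namespace IsMinCounterexample

theorem two_le_degreeIn (h : G.IsMinCounterexample S k) {v : V} (hv : v ∈ S) :
    2 ≤ G.degreeIn S v := by
  classical
  by_contra! hd
  obtain ⟨R, hvR, rfl⟩ : ∃ R, v ∉ R ∧ insert v R = S :=
    ⟨S.erase v, Finset.notMem_erase _ _, Finset.insert_erase hv⟩
  refine h.not_hasCorePacking (.mono_left le_rfl (Finset.subset_insert _ _)
    (h.of_card_lt G R k ?_ h.two_le (h.threshold_le.trans (excess_insert_le h.two_le hvR ?_))))
  · rw [Finset.card_insert_of_notMem hvR]; exact Nat.lt_succ_self _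
  · omega

theorem degreeIn_near_or (h : G.IsMinCounterexample S k) {x y : V} (hx : x ∈ S) (hy : y ∈ S)
    (hxy : G.Adj x y) :
    (2 * k ≤ G.degreeIn S x + 1 ∧ G.degreeIn S x ≤ 2 * k) ∨
      (2 * k ≤ G.degreeIn S y + 1 ∧ G.degreeIn S y ≤ 2 * k) := by
  by_contra! hc
  exact h.not_hasCorePacking (.mono_left (deleteEdges_le _) subset_rfl
    (h.of_sum_lt _ (sum_degreeIn_deleteEdges_lt hxy hx hy)
      (h.threshold_le.trans (excess_le_excess_deleteEdges hxy hx hy (by omega) (by omega)))))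

/-- An edge in no triangle joins high vertices, and the excess is as small as possible. -/
theorem of_not_triangle (h : G.IsMinCounterexample S k) {x y : V} (hx : x ∈ S) (hy : y ∈ S)
    (hxy : G.Adj x y) (ht : ∀ w ∈ S, G.Adj y w → ¬ G.Adj x w) :
    2 * k ≤ G.degreeIn S x ∧ G.excess k S = packingThreshold k := by
  classical
  have hdx := h.two_le_degreeIn hx
  have hdy := h.two_le_degreeIn hy
  obtain ⟨R, hyR, hxR, rfl⟩ : ∃ R, y ∉ R ∧ x ∉ insert y R ∧ insert x (insert y R) = S := by
    refine ⟨(S.erase x).erase y, Finset.notMem_erase _ _, ?_, ?_⟩ <;>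
      rw [Finset.insert_erase (Finset.mem_erase.2 ⟨hxy.ne', hy⟩)]
    · exact Finset.notMem_erase _ _
    · exact Finset.insert_erase hx
  have hlt : (G.mergeInto x y).excess k (insert y R) < packingThreshold k := by
    by_contra! hc
    refine h.not_hasCorePacking (.of_mergeInto hxy hxR (h.of_card_lt _ _ k ?_ h.two_le hc))
    rw [Finset.card_insert_of_notMem hxR]; exact Nat.lt_succ_self _
  have hle := h.threshold_le
  have hk := h.two_le
  have heq := excess_mergeInto (k := k) hxy hyR hxR fun w hw => ht w (by simp [hw])
  unfold degreeSign at heq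
  split_ifs at heq <;> omega

open scoped Classical in
/-- Without a four-cycle, the second neighbourhood of a vertex would be too large. -/
theorem exists_four_cycle (h : G.IsMinCounterexample S k)
    (ht : ∀ x ∈ S, ∀ y ∈ S, ∀ z ∈ S, G.Adj x y → G.Adj y z → ¬ G.Adj x z) :
    (∀ v ∈ S, 2 * k ≤ G.degreeIn S v) ∧ (S.card : ℤ) = packingThreshold k ∧
    ∃ a ∈ S, ∃ b ∈ S, ∃ c ∈ S, ∃ d ∈ S, a ≠ c ∧ b ≠ d ∧
      G.Adj a b ∧ G.Adj b c ∧ G.Adj c d ∧ G.Adj d a := by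
  have hk := h.two_le
  have hdeg {v : V} (hv : v ∈ S) :
      2 * k ≤ G.degreeIn S v ∧ G.excess k S = packingThreshold k := by
    have := h.two_le_degreeIn hv
    obtain ⟨w, hw⟩ := Finset.card_pos.1 (this.trans_lt' zero_lt_two)
    rw [Finset.mem_filter] at hw
    exact h.of_not_triangle hv hw.1 hw.2 fun u hu => ht v hv w hw.1 u hu hw.2
  have hpos : 0 < packingThreshold k := by
    unfold packingThreshold; split_ifs <;> nlinarith
  have hne : S.Nonempty := by
    rw [Finset.nonempty_iff_ne_empty]
    rintro rfl
    have := h.threshold_le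
    simp [excess] at this
    omega
  obtain ⟨v, hv⟩ := hne
  have hcard : (S.card : ℤ) = packingThreshold k := by
    rw [← (hdeg hv).2, excess_eq_card fun w hw => (hdeg hw).1]
  refine ⟨fun v hv => (hdeg hv).1, hcard, ?_⟩
  by_contra! hc
  set N := S.filter (G.Adj v)
  have hdis : (N : Set V).PairwiseDisjoint fun u => (S.filter (G.Adj u)).erase v := by
    intro u hu u' hu' huu'
    refine Finset.disjoint_left.2 fun w hw hw' => ?_
    simp only [N, Finset.coe_filter, Set.mem_ofPred_eq] at hu hu'
    simp only [Finset.mem_erase, Finset.mem_filter] at hw hw'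
    exact hc v hv u hu.1 w hw.2.1 u' hu'.1 (Ne.symm hw.1) huu' hu.2 hw.2.2 hw'.2.2.symm hu'.2.symm
  have hle : N.card * (2 * k - 1) ≤ S.card := by
    have hsub : (N.biUnion fun u => (S.filter (G.Adj u)).erase v) ⊆ S := by
      simp only [Finset.biUnion_subset]
      exact fun u _ => (Finset.erase_subset _ _).trans (Finset.filter_subset _ _)
    refine le_trans ?_ (Finset.card_le_card hsub)
    rw [Finset.card_biUnion hdis, ← smul_eq_mul]
    refine Finset.card_nsmul_le_sum _ _ _ fun u hu => ?_
    have hu := Finset.mem_filter.1 hu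
    rw [Finset.card_erase_of_mem (Finset.mem_filter.2 ⟨hv, hu.2.symm⟩)]
    exact Nat.sub_le_sub_right (hdeg hu.1).1 1
  have hN : 2 * k ≤ N.card := (hdeg hv).1
  have hle' : (2 * k : ℤ) * (2 * k - 1) ≤ S.card := by
    have := (Nat.mul_le_mul_right (2 * k - 1) hN).trans hle
    zify [show 1 ≤ 2 * k by omega] at this
    exact this
  rw [hcard] at hle'
  unfold packingThreshold at hle'
  split_ifs at hle' with h2
  · subst h2; norm_num at hle'
  · nlinarith

theorem exists_triangle (h : G.IsMinCounterexample S k) :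
    ∃ x ∈ S, ∃ y ∈ S, ∃ z ∈ S, G.Adj x y ∧ G.Adj y z ∧ G.Adj x z := by
  classical
  have hk := h.two_le
  by_contra! ht
  obtain ⟨hdeg, hcard, a, ha, b, hb, c, hc, d, hd, hac, hbd, hab, hbc, hcd, hda⟩ :=
    h.exists_four_cycle ht
  set C : Finset V := {a, b, c, d}
  have hCS : C ⊆ S := by
    intro v hv
    simp only [C, Finset.mem_insert, Finset.mem_singleton] at hv
    rcases hv with rfl | rfl | rfl | rfl <;> assumption
  have hCcard : C.card = 4 := by
    simp [C, *, hab.ne, hbc.ne, hcd.ne, hda.ne']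
  have hC : G.IsCore C := by
    refine ⟨by simp [C], fun v hv => ?_⟩
    simp only [C, Finset.mem_insert, Finset.mem_singleton] at hv
    refine Finset.one_lt_card.2 ?_
    rcases hv with rfl | rfl | rfl | rfl
    · exact ⟨b, by simp [C, hab], d, by simp [C, hda.symm], hbd⟩
    · exact ⟨a, by simp [C, hab.symm], c, by simp [C, hbc], hac⟩
    · exact ⟨b, by simp [C, hbc.symm], d, by simp [C, hcd], hbd⟩
    · exact ⟨a, by simp [C, hda], c, by simp [C, hcd.symm], hac⟩
  have hle {v : V} (hv : v ∈ S) : G.degreeIn C v ≤ 2 := by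
    have h1 := ht v hv a ha b hb
    have h2 := ht v hv b hb c hc
    have h3 := ht v hv c hc d hd
    have h4 := ht v hv d hd a ha
    have hsub : C.filter (G.Adj v) ⊆ {a, c} ∨ C.filter (G.Adj v) ⊆ {b, d} := by
      simp only [Finset.subset_iff, C, Finset.mem_filter, Finset.mem_insert, Finset.mem_singleton]
      by_cases hva : G.Adj v a <;> by_cases hvc : G.Adj v c <;> grind
    rcases hsub with hsub | hsub <;> exact (Finset.card_le_card hsub).trans Finset.card_le_two
  have hdeg' {v : V} (hv : v ∈ S \ C) : 2 * k ≤ G.degreeIn (S \ C) v + 2 := by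
    have hvS := Finset.sdiff_subset hv
    have := hdeg v hvS
    have := hle hvS
    have := degreeIn_sdiff_add (G := G) hCS v
    omega
  have hcard' : (S \ C).card + 4 = S.card := by
    rw [← hCcard, Finset.card_sdiff_add_card_eq_card hCS]
  obtain ⟨j, rfl⟩ : ∃ j, k = j + 1 := ⟨k - 1, by omega⟩
  refine h.not_hasCorePacking (.of_sdiff hC hCS ?_)
  rcases hk.eq_or_lt with hk | hk
  · obtain rfl : j = 1 := by omega
    refine .of_isCore ⟨?_, fun v hv => ?_⟩ subset_rfl
    · rw [← Finset.card_pos]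
      simp [packingThreshold] at hcard
      omega
    · have := hdeg' hv; omega
  · refine h.of_card_lt _ _ _ (by omega) (by omega) ?_
    rw [excess_eq_card fun w hw => by have := hdeg' hw; omega]
    unfold packingThreshold at *
    rw [if_neg (by omega)] at hcard
    push_cast at hcard
    split_ifs with h2
    · subst h2; omega
    · have : (S.card : ℤ) = (S \ C).card + 4 := by exact_mod_cast hcard'.symm
      have : (3 : ℤ) ≤ j := by omega
      nlinarith

end IsMinCounterexample

open scoped Classical in
theorem excess_le_sum_sdiff_add_card (hT : T ⊆ S) :
    G.excess k S ≤ ∑ v ∈ S \ T, degreeSign k (G.degreeIn S v) + T.card := by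
  rw [excess, ← Finset.sum_sdiff hT]
  refine add_le_add_right
    ((Finset.sum_le_card_nsmul _ _ 1 fun v _ => degreeSign_le_one _ _).trans ?_) _
  simp

open scoped Classical in
/-- If removing `T` leaves a forest, then the remaining degrees are bounded by the number of
edges leaving `T`. -/
theorem sum_sdiff_degreeIn_le (hT : T ⊆ S) (hne : (S \ T).Nonempty)
    (h : ∀ C ⊆ S \ T, ¬ G.IsCore C) :
    ∑ v ∈ S \ T, G.degreeIn S v + 2 ≤ 2 * (S \ T).card + ∑ v ∈ T, G.degreeIn (S \ T) v := by
  have := sum_degreeIn_add_two_le hne h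
  rw [Finset.sum_congr rfl fun v _ => (degreeIn_sdiff_add hT v).symm, Finset.sum_add_distrib,
    sum_degreeIn_comm (S \ T) T]
  omega

open scoped Classical in
/-- The common neighbours in `S` of `x`, `y` and `z` of degree `2 * k - 1` or `2 * k`. -/
noncomputable def nearCommon (G : SimpleGraph V) (S : Finset V) (k : ℕ) (x y z : V) : Finset V :=
  S.filter fun w => G.Adj x w ∧ G.Adj y w ∧ G.Adj z w ∧
    2 * k ≤ G.degreeIn S w + 1 ∧ G.degreeIn S w ≤ 2 * k

theorem mem_nearCommon {x y z w : V} : w ∈ G.nearCommon S k x y z ↔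
    w ∈ S ∧ G.Adj x w ∧ G.Adj y w ∧ G.Adj z w ∧
      2 * k ≤ G.degreeIn S w + 1 ∧ G.degreeIn S w ≤ 2 * k := by
  classical
  exact Finset.mem_filter

open scoped Classical in
theorem triple_subset {x y z : V} (hx : x ∈ S) (hy : y ∈ S) (hz : z ∈ S) : {x, y, z} ⊆ S := by
  simp [Finset.insert_subset_iff, hx, hy, hz]

open scoped Classical in
theorem card_triple {x y z : V} (hxy : G.Adj x y) (hyz : G.Adj y z) (hxz : G.Adj x z) :
    ({x, y, z} : Finset V).card = 3 := by
  simp [hxy.ne, hyz.ne, hxz.ne]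

theorem card_nearCommon_add_two_le {x y z : V} (hy : y ∈ S) (hz : z ∈ S) (hxy : G.Adj x y)
    (hyz : G.Adj y z) (hxz : G.Adj x z) :
    (G.nearCommon S k x y z).card + 2 ≤ G.degreeIn S x := by
  classical
  have hyn : y ∉ G.nearCommon S k x y z := by simp [mem_nearCommon]
  have hzn : z ∉ insert y (G.nearCommon S k x y z) := by simp [mem_nearCommon, hyz.ne']
  rw [← add_assoc (_ : ℕ) 1 1, ← Finset.card_insert_of_notMem hyn,
    ← Finset.card_insert_of_notMem hzn]
  refine Finset.card_le_card fun w hw => ?_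
  simp only [Finset.mem_insert, mem_nearCommon] at hw
  rw [Finset.mem_filter]
  rcases hw with rfl | rfl | hw
  · exact ⟨hz, hxz⟩
  · exact ⟨hy, hxy⟩
  · exact ⟨hw.1, hw.2.1⟩

open scoped Classical in
/-- Removing a triangle and passing from `k + 1` to `k` lowers the excess by at most three plus the
number of common neighbours whose degree is `2 * k + 1` or `2 * k + 2`. -/
theorem excess_le_excess_sdiff_triple {x y z : V} (hx : x ∈ S) (hy : y ∈ S) (hz : z ∈ S)
    (hxy : G.Adj x y) (hyz : G.Adj y z) (hxz : G.Adj x z) :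
    G.excess (k + 1) S ≤
      G.excess k (S \ {x, y, z}) + (G.nearCommon S (k + 1) x y z).card + 3 := by
  have hT := triple_subset hx hy hz
  refine (excess_le_sum_sdiff_add_card hT).trans ?_
  rw [card_triple hxy hyz hxz]
  refine add_le_add_left ?_ _
  have hpt : ∀ w ∈ S \ {x, y, z}, degreeSign (k + 1) (G.degreeIn S w) ≤
      degreeSign k (G.degreeIn (S \ {x, y, z}) w) +
        if w ∈ G.nearCommon S (k + 1) x y z then 1 else 0 := by
    intro w hw
    have hwS := (Finset.mem_sdiff.1 hw).1
    have hd := degreeIn_sdiff_add (G := G) hT w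
    have h3 : G.degreeIn {x, y, z} w = (if G.Adj w z then 1 else 0) +
        (if G.Adj w y then 1 else 0) + if G.Adj w x then 1 else 0 := by
      rw [degreeIn_insert (by simp [hxy.ne, hxz.ne]), degreeIn_insert (by simp [hyz.ne]),
        ← insert_empty_eq z, degreeIn_insert (by simp), degreeIn_empty, zero_add]
    by_cases hall : G.Adj w z ∧ G.Adj w y ∧ G.Adj w x
    · rw [if_pos hall.1, if_pos hall.2.1, if_pos hall.2.2] at h3
      simp only [mem_nearCommon, hwS, hall.1.symm, hall.2.1.symm, hall.2.2.symm, true_and]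
      unfold degreeSign
      split_ifs <;> omega
    · have h2 : G.degreeIn {x, y, z} w ≤ 2 := by
        rw [h3]
        split_ifs <;> first | omega | tauto
      have hsign : degreeSign (k + 1) (G.degreeIn S w) ≤
          degreeSign k (G.degreeIn (S \ {x, y, z}) w) := by
        unfold degreeSign
        split_ifs <;> omega
      exact hsign.trans (le_add_of_nonneg_right (by split_ifs <;> omega))
  refine (Finset.sum_le_sum hpt).trans ?_
  rw [Finset.sum_add_distrib, Finset.sum_ite_mem]
  refine add_le_add_right ?_ _
  rw [Finset.sum_const, nsmul_eq_mul, mul_one]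
  exact_mod_cast Finset.card_le_card Finset.inter_subset_right

namespace IsMinCounterexample

theorem exists_near_triangle (h : G.IsMinCounterexample S k) :
    ∃ x ∈ S, ∃ y ∈ S, ∃ z ∈ S, G.Adj x y ∧ G.Adj y z ∧ G.Adj x z ∧
      G.degreeIn S x ≤ 2 * k ∧ G.degreeIn S y ≤ 2 * k := by
  obtain ⟨x, hx, y, hy, z, hz, hxy, hyz, hxz⟩ := h.exists_triangle
  have h1 := h.degreeIn_near_or hx hy hxy
  have h2 := h.degreeIn_near_or hy hz hyz
  have h3 := h.degreeIn_near_or hx hz hxz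
  by_cases hdx : G.degreeIn S x ≤ 2 * k
  · by_cases hdy : G.degreeIn S y ≤ 2 * k
    · exact ⟨x, hx, y, hy, z, hz, hxy, hyz, hxz, hdx, hdy⟩
    · exact ⟨x, hx, z, hz, y, hy, hxz, hyz.symm, hxy, hdx, by omega⟩
  · exact ⟨y, hy, z, hz, x, hx, hyz, hxz.symm, hxy.symm, by omega, by omega⟩

open scoped Classical in
theorem ne_two (h : G.IsMinCounterexample S k) : k ≠ 2 := by
  rintro rfl
  obtain ⟨x, hx, y, hy, z, hz, hxy, hyz, hxz, hdx, hdy⟩ := h.exists_near_triangle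
  set T : Finset V := {x, y, z}
  have hT : T ⊆ S := triple_subset hx hy hz
  have hcore : G.IsCore T := isCore_triple hxy hyz hxz
  have hfree : ∀ C ⊆ S \ T, ¬ G.IsCore C := fun C hC hCc =>
    h.not_hasCorePacking (.of_sdiff hcore hT (.of_isCore hCc hC))
  have hthr : 6 ≤ G.excess 2 S := h.threshold_le
  have hexc := excess_le_sum_sdiff_add_card (G := G) (k := 2) hT
  rw [card_triple hxy hyz hxz] at hexc
  have hne : (S \ T).Nonempty := by
    rw [Finset.nonempty_iff_ne_empty]
    intro he
    rw [he, Finset.sum_empty] at hexc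
    omega
  have hsum := sum_sdiff_degreeIn_le hT hne hfree
  have hout : ∑ v ∈ T, G.degreeIn (S \ T) v ≤ 4 + (S \ T).card := by
    have hbx := hcore.2 x (by simp [T])
    have hby := hcore.2 y (by simp [T])
    have hbx' := degreeIn_sdiff_add (G := G) hT x
    have hby' := degreeIn_sdiff_add (G := G) hT y
    have hbz := degreeIn_le_card (G := G) (S \ T) z
    have hsum (f : V → ℕ) : ∑ v ∈ T, f v = f x + (f y + f z) := by
      rw [Finset.sum_insert (by simp [hxy.ne, hxz.ne]), Finset.sum_insert (by simp [hyz.ne]),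
        Finset.sum_singleton]
    rw [hsum]
    omega
  have hsign : ∑ v ∈ S \ T, degreeSign 2 (G.degreeIn S v) ≤
      ∑ v ∈ S \ T, ((G.degreeIn S v : ℤ) - 3) := by
    refine Finset.sum_le_sum fun v hv => ?_
    have := h.two_le_degreeIn (Finset.sdiff_subset hv)
    unfold degreeSign
    split_ifs <;> omega
  rw [Finset.sum_sub_distrib, Finset.sum_const, nsmul_eq_mul, ← Nat.cast_sum] at hsign
  omega

theorem le_card_nearCommon (h : G.IsMinCounterexample S (k + 1)) (hk : 2 ≤ k) {x y z : V}
    (hx : x ∈ S) (hy : y ∈ S) (hz : z ∈ S)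
    (hxy : G.Adj x y) (hyz : G.Adj y z) (hxz : G.Adj x z) :
    packingThreshold (k + 1) - packingThreshold k ≤ (G.nearCommon S (k + 1) x y z).card + 2 := by
  classical
  by_contra! hc
  have hexc := excess_le_excess_sdiff_triple (k := k) hx hy hz hxy hyz hxz
  have hthr := h.threshold_le
  have hT := triple_subset hx hy hz
  have hcard := Finset.card_sdiff_add_card_eq_card hT
  rw [card_triple hxy hyz hxz] at hcard
  exact h.not_hasCorePacking (.of_sdiff (isCore_triple hxy hyz hxz) hT
    (h.of_card_lt _ _ k (by omega) hk (by omega)))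

theorem eq_three (h : G.IsMinCounterexample S k) : k = 3 := by
  have h2 := h.two_le
  have hne := h.ne_two
  obtain ⟨x, hx, y, hy, z, hz, hxy, hyz, hxz, hdx, hdy⟩ := h.exists_near_triangle
  obtain ⟨j, rfl⟩ : ∃ j, k = j + 1 := ⟨k - 1, by omega⟩
  have hle := h.le_card_nearCommon (by omega) hx hy hz hxy hyz hxz
  have hcard := card_nearCommon_add_two_le (k := j + 1) hy hz hxy hyz hxz
  by_contra hj
  unfold packingThreshold at hle
  rw [if_neg (by omega), if_neg (by omega)] at hle
  push_cast at hle
  have hsq : ((j : ℤ) + 1) ^ 2 = j ^ 2 + 2 * j + 1 := by ring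
  omega

/-- For `k = 3` there are two disjoint triangles on six vertices of degree at most six. -/
theorem exists_six (h : G.IsMinCounterexample S 3) :
    ∃ x ∈ S, ∃ y ∈ S, ∃ p ∈ S, ∃ q ∈ S, ∃ r ∈ S, ∃ s ∈ S,
      G.degreeIn S x ≤ 6 ∧ G.degreeIn S y ≤ 6 ∧ G.degreeIn S p ≤ 6 ∧ G.degreeIn S q ≤ 6 ∧
      G.degreeIn S r ≤ 6 ∧ G.degreeIn S s ≤ 6 ∧
      G.Adj x y ∧ G.Adj x p ∧ G.Adj x q ∧ G.Adj x r ∧ G.Adj x s ∧ G.Adj y p ∧ G.Adj y q ∧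
      G.Adj y r ∧ G.Adj y s ∧ G.Adj p q ∧ G.Adj p r ∧ G.Adj p s ∧ G.Adj q r ∧ s ≠ q ∧ s ≠ r := by
  classical
  have hcommon {x y z : V} (hx : x ∈ S) (hy : y ∈ S) (hz : z ∈ S)
      (hxy : G.Adj x y) (hyz : G.Adj y z) (hxz : G.Adj x z) :
      3 ≤ (G.nearCommon S 3 x y z).card := by
    have := h.le_card_nearCommon le_rfl hx hy hz hxy hyz hxz
    norm_num [packingThreshold] at this
    omega
  obtain ⟨x, hx, y, hy, z, hz, hxy, hyz, hxz, hdx, hdy⟩ := h.exists_near_triangle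
  obtain ⟨p, hp⟩ := Finset.card_pos.1 (Nat.zero_lt_of_lt (hcommon hx hy hz hxy hyz hxz))
  obtain ⟨hpS, hxp, hyp, -, -, hdp⟩ := mem_nearCommon.1 hp
  have hQ := hcommon hx hy hpS hxy hyp hxp
  obtain ⟨q, hq⟩ := Finset.card_pos.1 (Nat.zero_lt_of_lt hQ)
  obtain ⟨hqS, hxq, hyq, hpq, -, hdq⟩ := mem_nearCommon.1 hq
  have hR := hcommon hx hy hqS hxy hyq hxq
  obtain ⟨r, hr, hr'⟩ : ∃ r ∈ G.nearCommon S 3 x y p, r ∈ G.nearCommon S 3 x y q := by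
    by_contra! hc
    have hyn : y ∉ G.nearCommon S 3 x y p := by simp [mem_nearCommon]
    have hpn : p ∉ insert y (G.nearCommon S 3 x y p) := by simp [mem_nearCommon, hyp.ne']
    have hdis : Disjoint (insert p (insert y (G.nearCommon S 3 x y p)))
        ((G.nearCommon S 3 x y q).erase p) := by
      refine Finset.disjoint_left.2 fun w hw hw' => ?_
      rw [Finset.mem_erase] at hw'
      simp only [Finset.mem_insert] at hw
      rcases hw with rfl | rfl | hw
      · exact hw'.1 rfl
      · exact G.irrefl (mem_nearCommon.1 hw'.2).2.2.1
      · exact hc w hw hw'.2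
    have hsub : insert p (insert y (G.nearCommon S 3 x y p)) ∪
        (G.nearCommon S 3 x y q).erase p ⊆ S.filter (G.Adj x) := by
      intro w hw
      simp only [Finset.mem_union, Finset.mem_insert, Finset.mem_erase, mem_nearCommon] at hw
      rw [Finset.mem_filter]
      rcases hw with (rfl | rfl | hw) | hw
      · exact ⟨hpS, hxp⟩
      · exact ⟨hy, hxy⟩
      · exact ⟨hw.1, hw.2.1⟩
      · exact ⟨hw.2.1, hw.2.2.1⟩
    have hle := Finset.card_le_card hsub
    rw [Finset.card_union_of_disjoint hdis, Finset.card_insert_of_notMem hpn,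
      Finset.card_insert_of_notMem hyn] at hle
    have := Finset.pred_card_le_card_erase (s := G.nearCommon S 3 x y q) (a := p)
    unfold degreeIn at hdx
    omega
  obtain ⟨hrS, hxr, hyr, hpr, -, hdr⟩ := mem_nearCommon.1 hr
  have hqr := (mem_nearCommon.1 hr').2.2.2.1
  obtain ⟨s, hs, hsn⟩ : ∃ s ∈ G.nearCommon S 3 x y p, s ∉ ({q, r} : Finset V) :=
    Finset.exists_mem_notMem_of_card_lt_card (Finset.card_le_two.trans_lt hQ)
  obtain ⟨hsS, hxs, hys, hps, -, hds⟩ := mem_nearCommon.1 hs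
  simp only [Finset.mem_insert, Finset.mem_singleton, not_or] at hsn
  exact ⟨x, hx, y, hy, p, hpS, q, hqS, r, hrS, s, hsS, hdx, hdy, hdp, hdq, hdr, hds, hxy, hxp, hxq,
    hxr, hxs, hyp, hyq, hyr, hys, hpq, hpr, hps, hqr, hsn.1, hsn.2⟩

open scoped Classical in
theorem ne_three (h : G.IsMinCounterexample S k) : k ≠ 3 := by
  rintro rfl
  obtain ⟨x, hx, y, hy, p, hp, q, hq, r, hr, s, hs, hdx, hdy, hdp, hdq, hdr, hds, hxy, hxp, hxq,
    hxr, hxs, hyp, hyq, hyr, hys, hpq, hpr, hps, hqr, hsq, hsr⟩ := h.exists_six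
  have hcore₁ : G.IsCore {p, q, r} := isCore_triple hpq hqr hpr
  have hcore₂ : G.IsCore {x, y, s} := isCore_triple hxy hys hxs
  have hsub₁ : {p, q, r} ⊆ S := triple_subset hp hq hr
  have hsub₂ : {x, y, s} ⊆ S := triple_subset hx hy hs
  have hdis : Disjoint ({x, y, s} : Finset V) {p, q, r} := by
    simp [Finset.disjoint_left, hxp.ne, hxq.ne, hxr.ne, hyp.ne, hyq.ne, hyr.ne, hps.ne', hsq, hsr]
  have hsub₂' : {x, y, s} ⊆ S \ {p, q, r} := Finset.subset_sdiff.2 ⟨hsub₂, hdis⟩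
  set T : Finset V := {p, q, r} ∪ {x, y, s} with hTdef
  have hT : T ⊆ S := Finset.union_subset hsub₁ hsub₂
  have hcard : T.card = 6 := by
    rw [hTdef, Finset.card_union_of_disjoint hdis.symm, card_triple hpq hqr hpr,
      card_triple hxy hys hxs]
  have hfree : ∀ C ⊆ S \ T, ¬ G.IsCore C := fun C hC hCc =>
    h.not_hasCorePacking (.of_sdiff hcore₁ hsub₁ (.of_sdiff hcore₂ hsub₂' (.of_isCore hCc
      (by rwa [sdiff_sdiff_left]))))
  have hthr : 11 ≤ G.excess 3 S := by
    have := h.threshold_le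
    norm_num [packingThreshold] at this
    exact this
  have hexc := excess_le_sum_sdiff_add_card (G := G) (k := 3) hT
  rw [hcard] at hexc
  have hne : (S \ T).Nonempty := by
    rw [Finset.nonempty_iff_ne_empty]
    intro he
    rw [he, Finset.sum_empty] at hexc
    omega
  have hsum := sum_sdiff_degreeIn_le hT hne hfree
  have hxT : x ∈ T := by simp [T]
  have hout : ∑ v ∈ T, G.degreeIn (S \ T) v ≤ 21 := by
    have hx5 : 5 ≤ G.degreeIn T x := by
      have : ({y, p, q, r, s} : Finset V).card = 5 := by
        simp [hyp.ne, hyq.ne, hyr.ne, hys.ne, hpq.ne, hpr.ne, hps.ne, hqr.ne, hsq.symm, hsr.symm]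
      rw [← this]
      refine Finset.card_le_card fun v hv => ?_
      simp only [Finset.mem_insert, Finset.mem_singleton] at hv
      rcases hv with rfl | rfl | rfl | rfl | rfl <;> simp [T, *]
    have hx1 : G.degreeIn (S \ T) x ≤ 1 := by
      have := degreeIn_sdiff_add (G := G) hT x
      omega
    have hle : ∀ v ∈ T.erase x, G.degreeIn (S \ T) v ≤ 4 := by
      intro v hv
      have hvT := Finset.mem_of_mem_erase hv
      have hv6 : G.degreeIn S v ≤ 6 := by
        simp only [T, Finset.mem_union, Finset.mem_insert, Finset.mem_singleton] at hvT
        rcases hvT with (rfl | rfl | rfl) | (rfl | rfl | rfl) <;> assumption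
      have hv2 : 2 ≤ G.degreeIn T v := by
        rcases Finset.mem_union.1 hvT with hv | hv
        · exact (hcore₁.2 v hv).trans (degreeIn_mono Finset.subset_union_left v)
        · exact (hcore₂.2 v hv).trans (degreeIn_mono Finset.subset_union_right v)
      have := degreeIn_sdiff_add (G := G) hT v
      omega
    have := Finset.sum_le_card_nsmul _ (fun v => G.degreeIn (S \ T) v) 4 hle
    rw [Finset.card_erase_of_mem hxT, hcard, smul_eq_mul] at this
    rw [← Finset.add_sum_erase _ _ hxT]
    omega
  have hsign : ∑ v ∈ S \ T, 4 * degreeSign 3 (G.degreeIn S v) ≤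
      ∑ v ∈ S \ T, ((G.degreeIn S v : ℤ) - 2) := by
    refine Finset.sum_le_sum fun v hv => ?_
    have := h.two_le_degreeIn (Finset.sdiff_subset hv)
    unfold degreeSign
    split_ifs <;> omega
  rw [Finset.sum_sub_distrib, Finset.sum_const, nsmul_eq_mul, ← Nat.cast_sum,
    ← Finset.mul_sum] at hsign
  omega

end IsMinCounterexample

theorem not_isMinCounterexample : ¬ G.IsMinCounterexample S k := fun h => h.ne_three h.eq_three

theorem hasCorePacking_of_packingThreshold_le (hk : 2 ≤ k)
    (h : packingThreshold k ≤ G.excess k S) : G.HasCorePacking S k := by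
  induction hn : S.card using Nat.strong_induction_on generalizing G S k with
  | _ n ih =>
    subst hn
    induction hm : ∑ v ∈ S, G.degreeIn S v using Nat.strong_induction_on generalizing G with
    | _ m ih' =>
      subst hm
      by_contra hc
      exact not_isMinCounterexample ⟨hk, h, hc, fun G' S' k' hlt hk' h' => ih _ hlt hk' h' rfl,
        fun G' hlt h' => ih' _ hlt h' rfl⟩

theorem HasCorePacking.hasDisjointCycles (h : G.HasCorePacking S k) :
    HasDisjointCycles G k := by
  obtain ⟨c, hc, hd⟩ := h
  choose v p hp hpc using fun i => (hc i).2.exists_isCycle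
  exact ⟨fun i => ⟨v i, p i⟩, hp, fun i j hij w hwi hwj =>
    Finset.disjoint_left.1 (hd i j hij) (hpc i w hwi) (hpc j w hwj)⟩

theorem degreeIn_univ [Fintype V] [DecidableRel G.Adj] (v : V) :
    G.degreeIn Finset.univ v = G.degree v := by
  rw [degreeIn, ← card_neighborFinset_eq_degree]
  congr 1
  ext w
  simp

end SimpleGraph

theorem SimpleGraph.excess_univ {V : Type*} [Fintype V] (G : SimpleGraph V) [DecidableRel G.Adj]
    {k : ℕ} (hk : 0 < k) :
    G.excess k Finset.univ = (highSet G k).card - (lowSet G k).card := by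
  simp only [excess, highSet, lowSet, Finset.card_filter, Nat.cast_sum, degreeIn_univ]
  rw [← Finset.sum_sub_distrib]
  refine Finset.sum_congr rfl fun v _ => ?_
  unfold degreeSign
  split_ifs <;> omega

/-- Dirac–Erdős: if the number of high vertices exceeds the number of low vertices by at
least `k² + 2k - 4`, then `G` has `k` disjoint cycles. -/
theorem dirac_erdos {V : Type*} [Fintype V] (G : SimpleGraph V) [DecidableRel G.Adj]
    (k : ℕ) (hk : 3 ≤ k)
    (h : (lowSet G k).card + (k ^ 2 + 2 * k - 4) ≤ (highSet G k).card) :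
    HasDisjointCycles G k := by
  refine (SimpleGraph.hasCorePacking_of_packingThreshold_le (S := Finset.univ)
    (by omega) ?_).hasDisjointCycles
  rw [G.excess_univ (by omega), SimpleGraph.packingThreshold, if_neg (by omega)]
  have : 4 ≤ k ^ 2 + 2 * k := by nlinarith
  zify [this] at h
  linarith
end
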